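/- arXiv:1511.01618 — 2 statements merged into one kernel-verified Lean document; each statement's English description precedes it below -/
import Mathlib

section
/- Let W_n be the number of white balls at time n in a triangular urn (model M or model R) with 0 < Λ ≤ 1 and a_m = 0, and let 𝔚_∞ be the almost sure limit of the martingale 𝔚_n := g_n·W_n. Then the distribution of 𝔚_∞ is absolutely continuous and admits a density on (0,∞); this density is bounded if either (Λ < 1 and W_0 ≥ a_{m−1}) or (Λ = 1 and W_0 ≥ a_{m−1} and B_0 ≥ a_{m−1}). -/
open MeasureTheory ProbabilityTheory Filter Set Topology

noncomputable section

/-- Probability of drawing `k` white balls in a sample of size `m` from an urn with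
`w` white and `b` black balls, drawing *without* replacement (model M). -/
def sampleProbM (m k w b : ℕ) : ℝ :=
  (Nat.choose w k * Nat.choose b (m - k) : ℝ) / (Nat.choose (w + b) m : ℝ)

/-- Probability of drawing `k` white balls in a sample of size `m` from an urn with
`w` white and `b` black balls, drawing *with* replacement (model R). -/
def sampleProbR (m k w b : ℕ) : ℝ :=
  (Nat.choose m k : ℝ) * (w : ℝ) ^ k * (b : ℝ) ^ (m - k) / ((w : ℝ) + (b : ℝ)) ^ m

/-- A balanced affine tenable two-color urn scheme with multiple drawings.
`mdlM = true` is model M (sampling without replacement), `mdlM = false` is model R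
(sampling with replacement).  `W n`, `B n` are the numbers of white and black balls
after `n` draws (ℕ-valued, which encodes tenability), `R (n+1)` is the number of white
balls in the `(n+1)`-st sample, and `F` is the filtration generated by the draws. -/
structure UrnScheme {Ω : Type*} [m0 : MeasurableSpace Ω] (μ : Measure Ω)
    (mdlM : Bool) (m : ℕ) (a b : ℕ → ℤ) (σ : ℤ) (W0 B0 : ℕ)
    (W B : ℕ → Ω → ℕ) (R : ℕ → Ω → ℕ) (F : Filtration ℕ m0) : Prop where
  hm : 1 ≤ m
  hσ : 1 ≤ σ
  balanced : ∀ k ≤ m, a k + b k = σ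
  affine : ∀ k ≤ m, a k = ((m : ℤ) - (k : ℤ)) * (a (m - 1) - a m) + a m
  initW : ∀ ω, W 0 ω = W0
  initB : ∀ ω, B 0 ω = B0
  sampleLe : ∀ n ω, R (n + 1) ω ≤ m
  sampleFit : ∀ n ω, (if mdlM then m else 1) ≤ W n ω + B n ω
  dynW : ∀ n ω, (W (n + 1) ω : ℤ) = (W n ω : ℤ) + a (m - R (n + 1) ω)
  dynB : ∀ n ω, (B (n + 1) ω : ℤ) = (B n ω : ℤ) + b (m - R (n + 1) ω)
  measW : ∀ n, Measurable[F n] (W n)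
  measB : ∀ n, Measurable[F n] (B n)
  measR : ∀ n, Measurable[F (n + 1)] (R (n + 1))
  condLaw : ∀ n, ∀ k ≤ m,
      (μ[(({ω | R (n + 1) ω = k}).indicator fun _ => (1 : ℝ)) | F n])
        =ᵐ[μ] fun ω =>
          if mdlM then sampleProbM m k (W n ω) (B n ω)
          else sampleProbR m k (W n ω) (B n ω)

/-- The urn index `Λ = m (a_{m-1} - a_m) / σ`. -/
def urnIndex (m : ℕ) (a : ℕ → ℤ) (σ : ℤ) : ℝ :=
  (m : ℝ) * ((a (m - 1) : ℝ) - (a m : ℝ)) / (σ : ℝ)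

/-- `ζ = a_m / (1 - Λ)`. -/
def urnZeta (m : ℕ) (a : ℕ → ℤ) (σ : ℤ) : ℝ :=
  (a m : ℝ) / (1 - urnIndex m a σ)

/-- `Q = Γ(T₀/σ + Λ) / Γ(T₀/σ)`. -/
def urnQ (T0 : ℕ) (σ : ℤ) (Λ : ℝ) : ℝ :=
  Real.Gamma ((T0 : ℝ) / (σ : ℝ) + Λ) / Real.Gamma ((T0 : ℝ) / (σ : ℝ))

/-- `g_n = Q · Γ(n + T₀/σ) / Γ(n + T₀/σ + Λ)`. -/
def urnG (T0 : ℕ) (σ : ℤ) (Λ : ℝ) (n : ℕ) : ℝ :=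
  urnQ T0 σ Λ * Real.Gamma ((n : ℝ) + (T0 : ℝ) / (σ : ℝ)) /
    Real.Gamma ((n : ℝ) + (T0 : ℝ) / (σ : ℝ) + Λ)

/-- Convergence in distribution of the sequence `X n` (on `(Ω, μ)`) to the law `ν`,
i.e. weak convergence of the image measures. -/
def TendstoInDistribution {Ω : Type*} [MeasurableSpace Ω] (μ : Measure Ω)
    (X : ℕ → Ω → ℝ) (ν : Measure ℝ) : Prop :=
  ∀ f : BoundedContinuousFunction ℝ ℝ,
    Tendsto (fun n => ∫ ω, f (X n ω) ∂μ) atTop (𝓝 (∫ x, f x ∂ν))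

/-- The martingale `𝔚_n = g_n W_n` for triangular urns. -/
def frakW {Ω : Type*} (σ : ℤ) (Λ : ℝ) (T0 : ℕ) (W : ℕ → Ω → ℕ) (n : ℕ) (ω : Ω) : ℝ :=
  urnG T0 σ Λ n * (W n ω : ℝ)

/-- The random variable `η`: `𝔚_∞^{-1/2}` if `Λ < 1`, `(𝔚_∞(T₀ - 𝔚_∞))^{-1/2}` if `Λ = 1`. -/
def triEta {Ω : Type*} (Λ : ℝ) (T0 : ℕ) (Winf : Ω → ℝ) (ω : Ω) : ℝ :=
  if Λ < 1 then (Real.sqrt (Winf ω))⁻¹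
  else (Real.sqrt (Winf ω * ((T0 : ℝ) - Winf ω)))⁻¹

/-- The constant `β`: `√(W₀/a_{m-1})` if `Λ < 1`, `√(m E[𝔚_∞(T₀ - 𝔚_∞)])` if `Λ = 1`. -/
def triBeta {Ω : Type*} [MeasurableSpace Ω] (μ : Measure Ω) (Λ : ℝ) (m : ℕ) (a : ℕ → ℤ)
    (W0 T0 : ℕ) (Winf : Ω → ℝ) : ℝ :=
  if Λ < 1 then Real.sqrt ((W0 : ℝ) / (a (m - 1) : ℝ))
  else Real.sqrt ((m : ℝ) * ∫ ω, Winf ω * ((T0 : ℝ) - Winf ω) ∂μ)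

/-- The product `x (x - c) ⋯ (x - (n - 1) c)`. -/
def stepFactorial (c : ℝ) (n : ℕ) (x : ℝ) : ℝ := ∏ i ∈ Finset.range n, (x - i * c)

/-- `f v ε = f₀ v + ε f₁ v + O(ε²)`, locally uniformly in `v`. -/
def HasSecondOrderExpansion (f : ℝ → ℝ → ℝ) (f₀ f₁ : ℝ → ℝ) : Prop :=
  Continuous f₀ ∧ Continuous f₁ ∧ ∃ g : ℝ × ℝ → ℝ, Continuous g ∧
    ∀ v ε, f v ε = f₀ v + ε * f₁ v + ε ^ 2 * g (v, ε)

namespace HasSecondOrderExpansion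

theorem mul {f f' : ℝ → ℝ → ℝ} {f₀ f₁ f₀' f₁' : ℝ → ℝ}
    (hf : HasSecondOrderExpansion f f₀ f₁) (hf' : HasSecondOrderExpansion f' f₀' f₁') :
    HasSecondOrderExpansion (fun v ε => f v ε * f' v ε) (fun v => f₀ v * f₀' v)
      (fun v => f₁ v * f₀' v + f₀ v * f₁' v) := by
  obtain ⟨h0, h1, g, hg, e⟩ := hf
  obtain ⟨h0', h1', g', hg', e'⟩ := hf'
  refine ⟨by fun_prop, by fun_prop, fun p => f₁ p.1 * f₁' p.1 + f₀ p.1 * g' p + g p * f₀' p.1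
    + p.2 * (f₁ p.1 * g' p + g p * f₁' p.1) + p.2 ^ 2 * (g p * g' p), by fun_prop, ?_⟩
  intro v ε
  simp only [e, e']
  ring

theorem add {f f' : ℝ → ℝ → ℝ} {f₀ f₁ f₀' f₁' : ℝ → ℝ}
    (hf : HasSecondOrderExpansion f f₀ f₁) (hf' : HasSecondOrderExpansion f' f₀' f₁') :
    HasSecondOrderExpansion (fun v ε => f v ε + f' v ε) (fun v => f₀ v + f₀' v)
      (fun v => f₁ v + f₁' v) := by
  obtain ⟨h0, h1, g, hg, e⟩ := hf
  obtain ⟨h0', h1', g', hg', e'⟩ := hf'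
  refine ⟨by fun_prop, by fun_prop, fun p => g p + g' p, by fun_prop, fun v ε => ?_⟩
  simp only [e, e']
  ring

theorem sum {ι : Type*} (s : Finset ι) {f : ι → ℝ → ℝ → ℝ} {f₀ f₁ : ι → ℝ → ℝ}
    (hf : ∀ i ∈ s, HasSecondOrderExpansion (f i) (f₀ i) (f₁ i)) :
    HasSecondOrderExpansion (fun v ε => ∑ i ∈ s, f i v ε) (fun v => ∑ i ∈ s, f₀ i v)
      (fun v => ∑ i ∈ s, f₁ i v) := by
  classical
  induction s using Finset.induction_on with
  | empty => exact ⟨by simp [continuous_const], by simp [continuous_const], 0, continuous_zero,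
      by simp⟩
  | insert i s hi ih =>
    simp only [Finset.sum_insert hi]
    exact (hf i (Finset.mem_insert_self i s)).add
      (ih fun k hk => hf k (Finset.mem_insert_of_mem hk))

theorem const_mul (k : ℝ) {f : ℝ → ℝ → ℝ} {f₀ f₁ : ℝ → ℝ}
    (hf : HasSecondOrderExpansion f f₀ f₁) :
    HasSecondOrderExpansion (fun v ε => k * f v ε) (fun v => k * f₀ v) (fun v => k * f₁ v) := by
  obtain ⟨h0, h1, g, hg, e⟩ := hf
  refine ⟨by fun_prop, by fun_prop, fun p => k * g p, by fun_prop, fun v ε => ?_⟩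
  simp only [e]
  ring

theorem prod_linear {l : ℝ → ℝ} (hl : Continuous l) (α : ℕ → ℝ) (n : ℕ) :
    HasSecondOrderExpansion (fun v ε => ∏ i ∈ Finset.range n, (l v + α i * ε))
      (fun v => l v ^ n) (fun v => (∑ i ∈ Finset.range n, α i) * l v ^ (n - 1)) := by
  induction n with
  | zero => exact ⟨by fun_prop, by fun_prop, 0, continuous_zero, by simp⟩
  | succ n ih =>
    have hlin : HasSecondOrderExpansion (fun v ε => l v + α n * ε) l (fun _ => α n) :=
      ⟨hl, continuous_const, 0, continuous_zero, fun v ε => by simp [mul_comm]⟩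
    convert ih.mul hlin using 3 with v ε v v
    · rw [Finset.prod_range_succ]
    · rw [pow_succ]
    · rw [Finset.sum_range_succ]
      rcases n with _ | n
      · simp
      · simp only [Nat.add_sub_cancel]
        ring

/-- An expansion of order two is bounded by its remainder when its first two terms vanish. -/
theorem exists_bound {f : ℝ → ℝ → ℝ} {f₀ f₁ : ℝ → ℝ}
    (hf : HasSecondOrderExpansion f f₀ f₁) (h0 : ∀ v, f₀ v = 0) (h1 : ∀ v, f₁ v = 0) (V : ℝ) :
    ∃ C, 0 ≤ C ∧ ∀ v ∈ Icc 0 V, ∀ ε ∈ Icc (0 : ℝ) 1, f v ε ≤ C * ε ^ 2 := by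
  obtain ⟨-, -, g, hg, e⟩ := hf
  obtain ⟨C, hC⟩ := ((isCompact_Icc (a := (0 : ℝ)) (b := V)).prod
    (isCompact_Icc (a := (0 : ℝ)) (b := 1))).exists_bound_of_continuousOn hg.continuousOn
  refine ⟨|C|, abs_nonneg _, fun v hv ε hε => ?_⟩
  rw [e, h0, h1]
  have := hC (v, ε) ⟨hv, hε⟩
  rw [Real.norm_eq_abs] at this
  have h2 : g (v, ε) ≤ |C| := (le_abs_self _).trans (this.trans (le_abs_self _))
  nlinarith [mul_le_mul_of_nonneg_left h2 (sq_nonneg ε)]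

end HasSecondOrderExpansion

theorem sum_range_nat_cast (n : ℕ) : ∑ i ∈ Finset.range n, (i : ℝ) = n * (n - 1) / 2 := by
  induction n with
  | zero => simp
  | succ n ih => rw [Finset.sum_range_succ, ih]; push_cast; ring

theorem sum_choose_mul_pow_mul_one_sub_pow (m : ℕ) (v : ℝ) :
    ∑ j ∈ Finset.range (m + 1), (m.choose j : ℝ) * (v ^ j * (1 - v) ^ (m - j)) = 1 := by
  have := add_pow v (1 - v) m
  rw [add_sub_cancel, one_pow] at this
  refine Eq.trans ?_ this.symm
  exact Finset.sum_congr rfl fun j _ => by ring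

/-- The first order term in the expansion of the shifted sum of sampling probabilities. -/
theorem sum_choose_mul_first_order (m : ℕ) (h c v : ℝ) :
    ∑ j ∈ Finset.range (m + 2), ((m + 1).choose j : ℝ) *
      ((∑ i ∈ Finset.range j, (-(h * j + i * c))) * v ^ (j - 1) * (1 - v) ^ (m + 1 - j) +
        v ^ j * ((∑ i ∈ Finset.range (m + 1 - j), (h * j - i * c)) * (1 - v) ^ (m + 1 - j - 1)))
      = -((m + 1) * h) - c * ((m + 1) * m / 2) := by
  simp only [mul_add, Finset.sum_add_distrib]
  rw [Finset.sum_range_succ' _ (m + 1)]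
  rw [Finset.sum_range_succ (fun j => ((m + 1).choose j : ℝ) * (v ^ j * (_ * _))) (m + 1)]
  simp only [Finset.range_zero, Finset.sum_empty, zero_mul, mul_zero, add_zero, Nat.sub_self]
  rw [← Finset.sum_add_distrib]
  have key : ∀ j ∈ Finset.range (m + 1), ((m + 1).choose (j + 1) : ℝ) *
      ((∑ i ∈ Finset.range (j + 1), (-(h * ((j + 1 : ℕ) : ℝ) + i * c))) * v ^ (j + 1 - 1) *
        (1 - v) ^ (m + 1 - (j + 1))) +
      ((m + 1).choose j : ℝ) * (v ^ j * ((∑ i ∈ Finset.range (m + 1 - j), (h * j - i * c)) *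
        (1 - v) ^ (m + 1 - j - 1)))
      = (-((m + 1) * h) - c * ((m + 1) * m / 2)) *
        ((m.choose j : ℝ) * (v ^ j * (1 - v) ^ (m - j))) := by
    intro j hj
    have hj' : j ≤ m := Nat.lt_succ_iff.1 (Finset.mem_range.1 hj)
    have e1 : ((m + 1).choose (j + 1) : ℝ) * (j + 1) = (m + 1) * m.choose j := by
      exact_mod_cast (Nat.add_one_mul_choose_eq m j).symm
    have e2 : ((m + 1).choose j : ℝ) * (m + 1 - j) = (m + 1) * m.choose j := by
      have := Nat.choose_mul_succ_eq m j
      have h3 : ((m + 1 - j : ℕ) : ℝ) = m + 1 - j := by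
        rw [Nat.cast_sub (by omega)]; push_cast; ring
      rw [← h3]
      have : ((m + 1).choose j * (m + 1 - j) : ℕ) = (m + 1) * m.choose j := by
        rw [← this, mul_comm]
      exact_mod_cast this
    have s1 : ∑ i ∈ Finset.range (j + 1), (-(h * ((j + 1 : ℕ) : ℝ) + i * c))
        = -(j + 1) * (h * (j + 1) + c * j / 2) := by
      rw [Finset.sum_neg_distrib, Finset.sum_add_distrib, ← Finset.sum_mul _ _ c,
        sum_range_nat_cast]
      simp only [Finset.sum_const, Finset.card_range, nsmul_eq_mul]
      push_cast
      ring
    have s2 : ∑ i ∈ Finset.range (m + 1 - j), (h * j - i * c)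
        = (m + 1 - j) * (h * j - c * (m - j) / 2) := by
      rw [Finset.sum_sub_distrib, ← Finset.sum_mul _ _ c, sum_range_nat_cast]
      simp only [Finset.sum_const, Finset.card_range, nsmul_eq_mul]
      rw [Nat.cast_sub (by omega)]
      push_cast
      ring
    rw [s1, s2, show m + 1 - (j + 1) = m - j by omega, show m + 1 - j - 1 = m - j by omega,
      Nat.add_sub_cancel]
    linear_combination (-(h * (j + 1) + c * j / 2) * (v ^ j * (1 - v) ^ (m - j))) * e1 +
      ((h * j - c * (m - j) / 2) * (v ^ j * (1 - v) ^ (m - j))) * e2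
  rw [Finset.sum_congr rfl key, ← Finset.mul_sum, sum_choose_mul_pow_mul_one_sub_pow, mul_one]

theorem stepFactorial_mul_scale (c : ℝ) (n : ℕ) (T v : ℝ) (hT : T ≠ 0) :
    stepFactorial c n (T * v) = T ^ n * ∏ i ∈ Finset.range n, (v + -(i * c) * T⁻¹) := by
  have : T ^ n = ∏ _i ∈ Finset.range n, T := by simp
  rw [stepFactorial, this, ← Finset.prod_mul_distrib]
  refine Finset.prod_congr rfl fun i _ => ?_
  field_simp
  ring

/-- Summing the sampling weights along the line `w + h j = x` gives `1 - m h / T` up to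
an error of order `T⁻²`. -/
theorem exists_sum_stepFactorial_le (m : ℕ) (hm : 1 ≤ m) (h c V : ℝ) :
    ∃ C, 0 ≤ C ∧ ∀ T x : ℝ, 1 ≤ T → 0 ≤ x → x ≤ V * T →
      ∑ j ∈ Finset.range (m + 1), (m.choose j : ℝ) *
        (stepFactorial c j (x - h * j) * stepFactorial c (m - j) (T - x + h * j))
      ≤ stepFactorial c m T * (1 - m * h / T) + C * T ^ m / T ^ 2 := by
  obtain ⟨m, rfl⟩ := Nat.exists_eq_add_of_le' hm
  have hG := HasSecondOrderExpansion.sum (Finset.range (m + 2)) fun j _ =>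
    ((HasSecondOrderExpansion.prod_linear (l := fun v => v) continuous_id
      (fun i => -(h * j + i * c)) j).mul (HasSecondOrderExpansion.prod_linear
        (l := fun v => 1 - v) (by fun_prop) (fun i => h * j - i * c) (m + 1 - j))).const_mul
      ((m + 1).choose j : ℝ)
  have hD := HasSecondOrderExpansion.prod_linear (l := fun _ => (1 : ℝ)) continuous_const
      (fun i => -(i * c)) (m + 1)
  have hL : HasSecondOrderExpansion (fun _ ε => 1 - (m + 1) * h * ε) (fun _ => 1)
      (fun _ => -((m + 1) * h)) :=
    ⟨continuous_const, continuous_const, 0, continuous_zero, fun v ε => by simp; ring⟩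
  have hfin := hG.add ((hD.mul hL).const_mul (-1))
  obtain ⟨C, hC0, hC⟩ := hfin.exists_bound (fun v => by
      rw [sum_choose_mul_pow_mul_one_sub_pow]; simp) (fun v => by
      rw [sum_choose_mul_first_order, Finset.sum_neg_distrib, ← Finset.sum_mul,
        sum_range_nat_cast]
      push_cast
      ring) V
  refine ⟨C, hC0, fun T x hT hx hxV => ?_⟩
  have hT0 : 0 < T := by linarith
  have := hC (x / T) ⟨by positivity, by rwa [div_le_iff₀ hT0]⟩ T⁻¹
    ⟨by positivity, inv_le_one_of_one_le₀ hT⟩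
  have e1 : stepFactorial c (m + 1) T
      = T ^ (m + 1) * ∏ i ∈ Finset.range (m + 1), (1 + -(i * c) * T⁻¹) := by
    rw [← stepFactorial_mul_scale c (m + 1) T 1 hT0.ne', mul_one]
  have e2 : ∀ j ∈ Finset.range (m + 1 + 1), ((m + 1).choose j : ℝ) *
        (stepFactorial c j (x - h * j) * stepFactorial c (m + 1 - j) (T - x + h * j))
      = T ^ (m + 1) * (((m + 1).choose j : ℝ) *
        ((∏ i ∈ Finset.range j, (x / T + -(h * j + i * c) * T⁻¹)) *
          ∏ i ∈ Finset.range (m + 1 - j), (1 - x / T + (h * j - i * c) * T⁻¹))) := by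
    intro j hj
    have hj' : j ≤ m + 1 := Nat.lt_succ_iff.1 (Finset.mem_range.1 hj)
    have a1 : x - h * j = T * (x / T - h * j / T) := by field_simp
    have a2 : T - x + h * j = T * (1 - x / T + h * j / T) := by field_simp
    rw [a1, a2, stepFactorial_mul_scale _ _ _ _ hT0.ne', stepFactorial_mul_scale _ _ _ _ hT0.ne']
    have a3 : T ^ (m + 1) = T ^ j * T ^ (m + 1 - j) := by rw [← pow_add]; congr 1; omega
    rw [a3]
    have a4 : ∀ i : ℕ, x / T - h * j / T + -(i * c) * T⁻¹ = x / T + -(h * j + i * c) * T⁻¹ :=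
      fun i => by ring
    have a5 : ∀ i : ℕ, 1 - x / T + h * j / T + -(i * c) * T⁻¹
        = 1 - x / T + (h * j - i * c) * T⁻¹ := fun i => by ring
    simp only [a4, a5]
    ring
  rw [Finset.sum_congr rfl e2, ← Finset.mul_sum, e1]
  have hTm : 0 < T ^ (m + 1) := by positivity
  have h5 := mul_le_mul_of_nonneg_left this hTm.le
  have e3 : C * T ^ (m + 1) / T ^ 2 = T ^ (m + 1) * (C * T⁻¹ ^ 2) := by field_simp
  rw [e3]
  push_cast
  have e4 : ((m : ℝ) + 1) * h / T = (m + 1) * h * T⁻¹ := by ring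
  rw [e4]
  linarith

theorem abs_stepFactorial_le {c K x : ℝ} {n m : ℕ} (hc0 : 0 ≤ c) (hc1 : c ≤ 1) (hn : n ≤ m)
    (hx : |x| ≤ K) : |stepFactorial c n x| ≤ (K + m) ^ n := by
  rw [stepFactorial, Finset.abs_prod]
  calc _ ≤ ∏ i ∈ Finset.range n, (K + m) := by
        refine Finset.prod_le_prod (fun _ _ => abs_nonneg _) fun i hi => ?_
        have hi' : (i : ℝ) ≤ m := by
          exact_mod_cast (Finset.mem_range.1 hi).le.trans hn
        have : |(i : ℝ) * c| ≤ m := by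
          rw [abs_of_nonneg (by positivity)]
          nlinarith [(Nat.cast_nonneg i : (0 : ℝ) ≤ i)]
        exact (abs_sub _ _).trans (by linarith)
    _ = _ := by simp

/-- A weight containing at least two bounded factors loses a factor of order `T²`. -/
theorem abs_stepFactorial_mul_le {c K x y T : ℝ} {m j : ℕ} (hc0 : 0 ≤ c) (hc1 : c ≤ 1)
    (hj : j ≤ m) (hj2 : 2 ≤ j) (hK : 1 ≤ K) (hT : 1 ≤ T) (hx : |x| ≤ K) (hy : |y| ≤ K * T) :
    |stepFactorial c j x * stepFactorial c (m - j) y| ≤ (K + m) ^ m * T ^ m / T ^ 2 := by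
  have hKm : 0 ≤ K + m := by positivity
  have h1 := abs_stepFactorial_le hc0 hc1 hj hx
  have h2 : |stepFactorial c (m - j) y| ≤ ((K + m) * T) ^ (m - j) := by
    refine (abs_stepFactorial_le hc0 hc1 (Nat.sub_le m j) hy).trans ?_
    gcongr
    nlinarith [(Nat.cast_nonneg m : (0 : ℝ) ≤ m)]
  have e : T ^ (m - j) * T ^ 2 ≤ T ^ m := by
    rw [← pow_add]
    exact pow_le_pow_right₀ hT (by omega)
  rw [abs_mul, le_div_iff₀ (by positivity)]
  calc _ ≤ (K + m) ^ j * ((K + m) * T) ^ (m - j) * T ^ 2 := by gcongr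
    _ = (K + m) ^ m * (T ^ (m - j) * T ^ 2) := by
        rw [mul_pow, ← mul_assoc, ← pow_add, Nat.add_sub_cancel' hj, mul_assoc]
    _ ≤ _ := by gcongr

theorem half_pow_le_stepFactorial {c T : ℝ} {m : ℕ} (hc1 : c ≤ 1)
    (hT1 : 1 ≤ T) (hT : 2 * m * m ≤ T) : T ^ m / 2 ≤ stepFactorial c m T := by
  rcases Nat.eq_zero_or_pos m with rfl | hm
  · simp [stepFactorial]; norm_num
  have hm1 : (1 : ℝ) ≤ m := by exact_mod_cast hm
  have hT0 : 0 < T := by linarith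
  have hmT : (m : ℝ) / T ≤ 1 := by rw [div_le_one hT0]; nlinarith
  have h1 : (T - m) ^ m ≤ stepFactorial c m T := by
    rw [stepFactorial, ← Finset.card_range m, ← Finset.prod_const, Finset.card_range]
    refine Finset.prod_le_prod (fun _ _ => by nlinarith) fun i hi => ?_
    have hi' : (i : ℝ) ≤ m := by exact_mod_cast (Finset.mem_range.1 hi).le
    nlinarith [(Nat.cast_nonneg i : (0 : ℝ) ≤ i)]
  have h2 : 1 + (m : ℝ) * (-(m / T)) ≤ (1 + -(m / T)) ^ m :=
    one_add_mul_le_pow (by linarith) m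
  have h3 : (1 : ℝ) / 2 ≤ 1 + (m : ℝ) * (-(m / T)) := by
    have : (m : ℝ) * (m / T) ≤ 1 / 2 := by
      rw [← mul_div_assoc, div_le_iff₀ hT0]; linarith
    linarith
  have h4 : (T - m) ^ m = T ^ m * (1 + -(m / T)) ^ m := by
    rw [← mul_pow]; congr 1; field_simp; ring
  rw [h4] at h1
  have : 0 < T ^ m := by positivity
  nlinarith

/-- The probability of `j` white balls in a sample of size `m` from an urn with `w` white balls
out of `T`, for both sampling models: `c = 1` without and `c = 0` with replacement. -/
def samplingWeight (c : ℝ) (m j : ℕ) (w T : ℝ) : ℝ :=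
  (m.choose j : ℝ) * (stepFactorial c j w * stepFactorial c (m - j) (T - w)) /
    stepFactorial c m T

/-- The number of white balls of a triangular urn, with `h = a_{m-1}` and total number of balls
`W0 + B0 + s n`. -/
structure TriangularProcess {Ω : Type*} [m0 : MeasurableSpace Ω] (μ : Measure Ω) (c : ℝ)
    (m h s W0 B0 : ℕ) (W R : ℕ → Ω → ℕ) (F : Filtration ℕ m0) : Prop where
  one_le_m : 1 ≤ m
  one_le_h : 1 ≤ h
  mul_le : m * h ≤ s
  one_le_white : 1 ≤ W0
  one_le_black : m * h = s → 1 ≤ B0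
  c_nonneg : 0 ≤ c
  c_le_one : c ≤ 1
  white_zero : ∀ ω, W 0 ω = W0
  dyn : ∀ n ω, W (n + 1) ω = W n ω + h * R (n + 1) ω
  sample_le : ∀ n ω, R (n + 1) ω ≤ m
  le_total : ∀ n ω, W n ω ≤ W0 + B0 + s * n
  measurable_white : ∀ n, Measurable[F n] (W n)
  weight_nonneg : ∀ n j y, j ≤ m → y ≤ W0 + B0 + s * n →
    0 ≤ samplingWeight c m j y ((W0 + B0 + s * n : ℕ) : ℝ)
  condLaw : ∀ n (E : Set Ω), MeasurableSet[F n] E → ∀ y j, j ≤ m → y ≤ W0 + B0 + s * n →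
    μ.real (E ∩ {ω | W n ω = y} ∩ {ω | R (n + 1) ω = j})
      = samplingWeight c m j y ((W0 + B0 + s * n : ℕ) : ℝ) * μ.real (E ∩ {ω | W n ω = y})

namespace TriangularProcess

variable {Ω : Type*} [m0 : MeasurableSpace Ω] {μ : Measure Ω} {c : ℝ} {m h s W0 B0 : ℕ}
  {W R : ℕ → Ω → ℕ} {F : Filtration ℕ m0}

theorem white_mono (S : TriangularProcess μ c m h s W0 B0 W R F) (ω : Ω) :
    Monotone fun n => W n ω :=
  monotone_nat_of_le_succ fun n => by simp only [S.dyn n ω]; omega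

theorem black_le_succ (S : TriangularProcess μ c m h s W0 B0 W R F) (ω : Ω) (n : ℕ) :
    W (n + 1) ω + s * n + (s - m * h) ≤ W n ω + s * (n + 1) := by
  have h1 := S.dyn n ω
  have h2 : h * R (n + 1) ω ≤ h * m := Nat.mul_le_mul_left _ (S.sample_le n ω)
  have h3 := S.mul_le
  rw [mul_comm h m] at h2
  rw [mul_add]
  omega

/-- Linear growth of the number of black balls. -/
theorem white_add_le (S : TriangularProcess μ c m h s W0 B0 W R F) (ω : Ω) {b N n : ℕ}
    (hn : N ≤ n) (hb : W N ω + b ≤ W0 + B0 + s * N) :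
    W n ω + b + (s - m * h) * (n - N) ≤ W0 + B0 + s * n := by
  induction n, hn using Nat.le_induction with
  | base => simpa using hb
  | succ n hn ih =>
    have := S.black_le_succ ω n
    rw [Nat.sub_add_comm hn, mul_add]
    omega

theorem one_le_total (S : TriangularProcess μ c m h s W0 B0 W R F) (n : ℕ) :
    1 + n ≤ W0 + B0 + s * n := by
  have h1 := S.one_le_white
  have h2 : 1 ≤ m * h := Nat.mul_pos S.one_le_m S.one_le_h
  have h3 : 1 * n ≤ s * n := Nat.mul_le_mul_right _ (h2.trans S.mul_le)
  omega

/-- One step of the recursion for the largest point probability of the number of white balls,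
on an event on which both colours are sufficiently represented. -/
theorem exists_step_bound [IsProbabilityMeasure μ]
    (S : TriangularProcess μ c m h s W0 B0 W R F) {N : ℕ} {E : Set Ω}
    (hE : MeasurableSet[F N] E) (hw : ∀ ω ∈ E, h ≤ W N ω)
    (hb : m * h = s → ∀ ω ∈ E, W N ω + h ≤ W0 + B0 + s * N) :
    ∃ C n₀, 0 ≤ C ∧ N ≤ n₀ ∧ 1 ≤ n₀ ∧ ∀ n, n₀ ≤ n → ∀ M : ℝ, 0 ≤ M →
      (∀ y, μ.real (E ∩ {ω | W n ω = y}) ≤ M) →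
      ∀ x, μ.real (E ∩ {ω | W (n + 1) ω = x}) ≤
        M * (1 - (m * h : ℝ) / (W0 + B0 + s * n : ℕ) + C / ((W0 + B0 + s * n : ℕ) : ℝ) ^ 2) := by
  obtain ⟨C, hC0, hC⟩ := exists_sum_stepFactorial_le m S.one_le_m h c (1 + s)
  have hmh1 : 1 ≤ m * h := Nat.mul_pos S.one_le_m S.one_le_h
  set K : ℝ := 1 + s + m * h with hK
  have hK1 : 1 ≤ K := by
    have : (0 : ℝ) ≤ s + m * h := by positivity
    linarith
  set L : ℝ := (K + m) ^ m with hL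
  have hL0 : 0 ≤ L := by positivity
  refine ⟨2 * (C + 2 ^ m * L), N + s + m * h + 2 * m * m + 1, by positivity, by omega, by omega,
    fun n hn M hM0 hM x => ?_⟩
  set t : ℕ := W0 + B0 + s * n with ht
  have hnt : 1 + n ≤ t := S.one_le_total n
  have hT1 : (1 : ℝ) ≤ t := by exact_mod_cast (by omega : 1 ≤ t)
  have hT0 : (0 : ℝ) < t := by linarith
  have hTm : 2 * (m : ℝ) * m ≤ t := by exact_mod_cast (by omega : 2 * m * m ≤ t)
  have hmhT : (m : ℝ) * h / t ≤ 1 := by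
    rw [div_le_one hT0]; exact_mod_cast (by omega : m * h ≤ t)
  rcases Set.eq_empty_or_nonempty (E ∩ {ω | W (n + 1) ω = x}) with hemp | ⟨ω, hωE, hωx⟩
  · rw [hemp, measureReal_empty]
    have : 0 ≤ 2 * (C + 2 ^ m * L) / (t : ℝ) ^ 2 := by positivity
    exact mul_nonneg hM0 (by linarith)
  have hωx : W (n + 1) ω = x := hωx
  have hxh : h ≤ x := by
    rw [← hωx]
    exact (hw ω hωE).trans (S.white_mono ω (by omega))
  have hxt : x ≤ t + s := by
    have := S.le_total (n + 1) ω
    rw [hωx, mul_add] at this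
    omega
  have hblack : ∀ j, j ≤ m → t < x - h * j → m * h = s ∧ j + 2 ≤ m := by
    intro j hj hlt
    rcases S.mul_le.eq_or_lt with heq | hlt'
    · refine ⟨heq, ?_⟩
      have := S.white_add_le ω (by omega : N ≤ n + 1) (hb heq ω hωE)
      rw [hωx, mul_add, heq, Nat.sub_self, zero_mul] at this
      by_contra! hcon
      have h1 : h * m ≤ h * (j + 1) := Nat.mul_le_mul_left _ (by omega)
      rw [mul_comm h m, mul_add] at h1
      omega
    · exfalso
      have := S.white_add_le ω (by omega : N ≤ n + 1) ((Nat.add_zero _).trans_le (S.le_total N ω))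
      have h1 : 1 * (n + 1 - N) ≤ (s - m * h) * (n + 1 - N) :=
        Nat.mul_le_mul_right _ (by omega)
      rw [hωx, mul_add] at this
      omega
  set D : ℝ := stepFactorial c m t with hD
  have hDhalf : (t : ℝ) ^ m / 2 ≤ D := half_pow_le_stepFactorial S.c_le_one hT1 hTm
  have hD0 : 0 < D := lt_of_lt_of_le (by positivity) hDhalf
  have hxt' : (x : ℝ) ≤ t + s := by exact_mod_cast hxt
  have hx0 : (0 : ℝ) ≤ x := Nat.cast_nonneg x
  have hs0 : (0 : ℝ) ≤ s := Nat.cast_nonneg s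
  have hmh0 : (0 : ℝ) ≤ m * h := by positivity
  have hst : (s : ℝ) ≤ s * t := le_mul_of_one_le_right hs0 hT1
  have hmht : (m : ℝ) * h ≤ m * h * t := le_mul_of_one_le_right hmh0 hT1
  have hKT : K * t = t + s * t + m * h * t := by rw [hK]; ring
  have hterm : ∀ j ∈ Finset.range (m + 1),
      μ.real (E ∩ {ω | W n ω + h * j = x} ∩ {ω | R (n + 1) ω = j}) ≤
        M / D * ((m.choose j : ℝ) *
          (stepFactorial c j (x - h * j) * stepFactorial c (m - j) (t - x + h * j))
          + (m.choose j : ℝ) * (L * t ^ m / t ^ 2)) := by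
    intro j hj
    have hj' : j ≤ m := Nat.lt_succ_iff.1 (Finset.mem_range.1 hj)
    have hrest : 0 ≤ (m.choose j : ℝ) * (L * t ^ m / t ^ 2) := by positivity
    have hjm : h * j ≤ m * h := by rw [mul_comm m h]; exact Nat.mul_le_mul_left _ hj'
    have hjm' : (h : ℝ) * j ≤ m * h := by exact_mod_cast hjm
    have hj0 : (0 : ℝ) ≤ h * j := by positivity
    have hinvalid : (∀ ω, W n ω + h * j ≠ x) →
        |stepFactorial c j (x - h * j) * stepFactorial c (m - j) (t - x + h * j)|
          ≤ L * t ^ m / t ^ 2 →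
        μ.real (E ∩ {ω | W n ω + h * j = x} ∩ {ω | R (n + 1) ω = j}) ≤
        M / D * ((m.choose j : ℝ) *
          (stepFactorial c j (x - h * j) * stepFactorial c (m - j) (t - x + h * j))
          + (m.choose j : ℝ) * (L * t ^ m / t ^ 2)) := by
      intro hne hle
      have : E ∩ {ω | W n ω + h * j = x} ∩ {ω | R (n + 1) ω = j} = ∅ := by
        ext ω'
        simp [hne ω']
      rw [this, measureReal_empty, ← mul_add]
      have := (abs_le.1 hle).1
      have h3 : (0 : ℝ) ≤ m.choose j := Nat.cast_nonneg _
      exact mul_nonneg (by positivity) (mul_nonneg h3 (by linarith))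
    by_cases hjx : h * j ≤ x
    · by_cases hjt : x - h * j ≤ t
      · have hset : {ω | W n ω + h * j = x} = {ω | W n ω = x - h * j} := by
          ext ω'
          simp only [mem_ofPred_eq]
          omega
        rw [hset, S.condLaw n E (F.mono (by omega) _ hE) _ j hj' hjt]
        have hp := S.weight_nonneg n j _ hj' hjt
        have hcast : ((x - h * j : ℕ) : ℝ) = x - h * j := by
          rw [Nat.cast_sub hjx]; push_cast; ring
        refine (mul_le_mul_of_nonneg_left (hM _) hp).trans ?_
        rw [samplingWeight, hcast, ← ht, sub_sub_eq_add_sub, add_sub_right_comm, ← hD,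
          div_mul_eq_mul_div, div_mul_eq_mul_div, mul_comm _ M]
        refine div_le_div_of_nonneg_right ?_ hD0.le
        exact mul_le_mul_of_nonneg_left (le_add_of_nonneg_right hrest) hM0
      · refine hinvalid (fun ω' hω' => ?_) ?_
        · have := S.le_total n ω'
          omega
        · obtain ⟨heq, hj2⟩ := hblack j hj' (by omega)
          have hlow : (t : ℝ) ≤ x - h * j := by
            have : ((t + h * j : ℕ) : ℝ) ≤ (x : ℕ) := Nat.cast_le.2 (by omega)
            push_cast at this
            linarith
          have := abs_stepFactorial_mul_le (m := m) (j := m - j) (K := K) (T := t)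
            (x := t - x + h * j) (y := x - h * j) S.c_nonneg S.c_le_one (by omega) (by omega)
            hK1 hT1 (abs_le.2 ⟨by linarith, by linarith⟩) (abs_le.2 ⟨by linarith, by linarith⟩)
          rwa [Nat.sub_sub_self hj', mul_comm (stepFactorial _ _ _)] at this
    · refine hinvalid (fun ω' hω' => by omega) ?_
      have hj2 : 2 ≤ j := by
        by_contra! hcon
        have h1 : h * j ≤ h * 1 := Nat.mul_le_mul_left _ (by omega)
        omega
      have hlow : (x : ℝ) ≤ h * j := by exact_mod_cast (by omega : x ≤ h * j)
      exact abs_stepFactorial_mul_le S.c_nonneg S.c_le_one hj' hj2 hK1 hT1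
        (abs_le.2 ⟨by linarith, by linarith⟩)
        (abs_le.2 ⟨by linarith, by linarith⟩)
  have hunion : E ∩ {ω | W (n + 1) ω = x} ⊆ ⋃ j ∈ Finset.range (m + 1),
      E ∩ {ω | W n ω + h * j = x} ∩ {ω | R (n + 1) ω = j} := by
    rintro ω' ⟨h1, h2⟩
    simp only [mem_iUnion, Finset.mem_range]
    refine ⟨R (n + 1) ω', Nat.lt_succ_iff.2 (S.sample_le n ω'), ⟨h1, ?_⟩, rfl⟩
    rw [mem_ofPred_eq, ← S.dyn n ω']
    exact h2
  have hchoose : ∑ j ∈ Finset.range (m + 1), (m.choose j : ℝ) = 2 ^ m := by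
    exact_mod_cast Nat.sum_range_choose m
  calc μ.real (E ∩ {ω | W (n + 1) ω = x})
      ≤ ∑ j ∈ Finset.range (m + 1),
          μ.real (E ∩ {ω | W n ω + h * j = x} ∩ {ω | R (n + 1) ω = j}) :=
        (measureReal_mono hunion (measure_ne_top _ _)).trans (measureReal_biUnion_finset_le _ _)
    _ ≤ _ := Finset.sum_le_sum hterm
    _ = M / D * (∑ j ∈ Finset.range (m + 1), (m.choose j : ℝ) *
          (stepFactorial c j (x - h * j) * stepFactorial c (m - j) (t - x + h * j))
          + 2 ^ m * (L * t ^ m / t ^ 2)) := by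
        rw [← Finset.mul_sum, Finset.sum_add_distrib, ← Finset.sum_mul, hchoose]
    _ ≤ M / D * ((D * (1 - m * h / t) + C * t ^ m / t ^ 2) + 2 ^ m * (L * t ^ m / t ^ 2)) := by
        exact mul_le_mul_of_nonneg_left
          (add_le_add_left (hC t x hT1 hx0 (by linarith)) _) (div_nonneg hM0 hD0.le)
    _ = M / D * (D * (1 - m * h / t) + (C + 2 ^ m * L) * t ^ m / t ^ 2) := by ring
    _ ≤ M / D * (D * (1 - m * h / t) + (C + 2 ^ m * L) * (2 * D) / t ^ 2) := by
        refine mul_le_mul_of_nonneg_left (add_le_add_right ?_ _) (div_nonneg hM0 hD0.le)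
        refine div_le_div_of_nonneg_right ?_ (by positivity)
        exact mul_le_mul_of_nonneg_left (by linarith) (by positivity)
    _ = _ := by
        field_simp

end TriangularProcess

/-- A recursion losing a factor `1 - δ / (n + 1)` at each step forces convergence to zero. -/
theorem tendsto_zero_of_le_mul_one_sub_div {u : ℕ → ℝ} {δ : ℝ} {n₀ : ℕ} (hδ : 0 < δ)
    (h0 : ∀ n, 0 ≤ u n) (hu : ∀ n, n₀ ≤ n → u (n + 1) ≤ u n * (1 - δ / (n + 1))) :
    Tendsto u atTop (𝓝 0) := by
  set H : ℕ → ℝ := fun n => ∑ i ∈ Finset.range n, 1 / ((i : ℝ) + 1) with hH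
  have hbound : ∀ n, n₀ ≤ n → u n ≤ u n₀ * Real.exp (δ * H n₀) * Real.exp (-(δ * H n)) := by
    intro n hn
    induction n, hn using Nat.le_induction with
    | base => rw [mul_assoc, ← Real.exp_add, add_neg_cancel, Real.exp_zero, mul_one]
    | succ n hn ih =>
      have e : H (n + 1) = H n + 1 / (n + 1) := Finset.sum_range_succ _ _
      have h1 : 1 - δ / ((n : ℝ) + 1) ≤ Real.exp (-(δ / (n + 1))) := by
        have := Real.add_one_le_exp (-(δ / ((n : ℝ) + 1)))
        linarith
      calc u (n + 1) ≤ u n * (1 - δ / (n + 1)) := hu n hn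
        _ ≤ u n * Real.exp (-(δ / (n + 1))) := mul_le_mul_of_nonneg_left h1 (h0 n)
        _ ≤ u n₀ * Real.exp (δ * H n₀) * Real.exp (-(δ * H n)) * Real.exp (-(δ / (n + 1))) :=
            mul_le_mul_of_nonneg_right ih (Real.exp_pos _).le
        _ = _ := by
            rw [mul_assoc, ← Real.exp_add, e]
            congr 2
            ring
  have hlim : Tendsto (fun n => u n₀ * Real.exp (δ * H n₀) * Real.exp (-(δ * H n)))
      atTop (𝓝 0) := by
    rw [← mul_zero (u n₀ * Real.exp (δ * H n₀))]
    refine Tendsto.const_mul _ (Real.tendsto_exp_neg_atTop_nhds_zero.comp ?_)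
    exact Real.tendsto_sum_range_one_div_nat_succ_atTop.const_mul_atTop hδ
  exact squeeze_zero' (Eventually.of_forall h0)
    (eventually_atTop.2 ⟨n₀, hbound⟩) hlim

/-- The relative loss in the falling product when the argument is lowered. -/
theorem stepFactorial_sub_le {c T w : ℝ} {m : ℕ} (hm : 1 ≤ m) (hc1 : c ≤ 1)
    (hw : 0 ≤ w) (hT : w + m ≤ T) :
    stepFactorial c m (T - w) ≤ (1 - w / T) * stepFactorial c m T := by
  obtain ⟨k, rfl⟩ := Nat.exists_eq_add_of_le' hm
  push_cast at hT
  have hk : (0 : ℝ) ≤ k := Nat.cast_nonneg k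
  have hT0 : 0 < T := by linarith
  rw [stepFactorial, stepFactorial, Finset.prod_range_succ', Finset.prod_range_succ']
  have hle : ∏ i ∈ Finset.range k, (T - w - ((i + 1 : ℕ) : ℝ) * c)
      ≤ ∏ i ∈ Finset.range k, (T - ((i + 1 : ℕ) : ℝ) * c) := by
    refine Finset.prod_le_prod (fun i hi => ?_) fun i _ => by linarith
    have : ((i + 1 : ℕ) : ℝ) ≤ k := by exact_mod_cast Finset.mem_range.1 hi
    nlinarith [(Nat.cast_nonneg (i + 1) : (0 : ℝ) ≤ _)]
  have e : (1 - w / T) * ((∏ i ∈ Finset.range k, (T - ((i + 1 : ℕ) : ℝ) * c)) *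
      (T - ((0 : ℕ) : ℝ) * c))
      = (∏ i ∈ Finset.range k, (T - ((i + 1 : ℕ) : ℝ) * c)) * (T - w) := by
    rw [Nat.cast_zero, zero_mul, sub_zero, mul_left_comm, sub_mul, div_mul_cancel₀ _ hT0.ne',
      one_mul]
  rw [e, Nat.cast_zero, zero_mul, sub_zero]
  exact mul_le_mul_of_nonneg_right hle (by linarith)

theorem cast_total_add_le (W0 B0 s n : ℕ) {k : ℝ} (hk : 0 ≤ k) :
    ((W0 + B0 + s * n : ℕ) : ℝ) + k ≤ (W0 + B0 + s + k) * (n + 1) := by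
  push_cast
  have : (0 : ℝ) ≤ (W0 + B0 + k) * n + s := by positivity
  nlinarith

namespace TriangularProcess

variable {Ω : Type*} [m0 : MeasurableSpace Ω] {μ : Measure Ω} {c : ℝ} {m h s W0 B0 : ℕ}
  {W R : ℕ → Ω → ℕ} {F : Filtration ℕ m0}

theorem weight_zero_le (S : TriangularProcess μ c m h s W0 B0 W R F) {w T : ℝ} (hw : 0 ≤ w)
    (hT : w + m ≤ T) (hT' : 2 * m * m ≤ T) :
    samplingWeight c m 0 w T ≤ 1 - w / T ∧ samplingWeight c m m (T - w) T ≤ 1 - w / T := by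
  have hm1 : (1 : ℝ) ≤ m := by exact_mod_cast S.one_le_m
  have h1 : 1 ≤ T := by linarith
  have hD : 0 < stepFactorial c m T :=
    lt_of_lt_of_le (by positivity) (half_pow_le_stepFactorial S.c_le_one h1 hT')
  have := stepFactorial_sub_le S.one_le_m S.c_le_one hw hT
  rw [← div_le_iff₀ hD] at this
  have h0 : ∀ x, stepFactorial c 0 x = 1 := fun x => Finset.prod_range_zero _
  constructor
  · simpa [samplingWeight, h0] using this
  · simpa [samplingWeight, h0] using this

theorem tendsto_normalisation (S : TriangularProcess μ c m h s W0 B0 W R F) {g : ℕ → ℝ}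
    (hg0 : ∀ n, 0 < g n)
    (hg : ∀ n, g (n + 1) * ((W0 + B0 + s * n : ℕ) + m * h) = g n * (W0 + B0 + s * n : ℕ)) :
    Tendsto g atTop (𝓝 0) := by
  have hw1 : (1 : ℝ) ≤ W0 := by exact_mod_cast S.one_le_white
  have hm1 : (1 : ℝ) ≤ m := by exact_mod_cast S.one_le_m
  have hh1 : (1 : ℝ) ≤ h := by exact_mod_cast S.one_le_h
  have hu : 0 < (m : ℝ) * h := by positivity
  refine tendsto_zero_of_le_mul_one_sub_div (δ := m * h / (W0 + B0 + s + m * h)) (n₀ := 0)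
    (by positivity) (fun n => (hg0 n).le) fun n _ => ?_
  have h1 := cast_total_add_le W0 B0 s n hu.le
  set T : ℝ := ((W0 + B0 + s * n : ℕ) : ℝ)
  have hT0 : 0 ≤ T := Nat.cast_nonneg _
  have h2 : g (n + 1) = g n * (1 - m * h / (T + m * h)) := by
    have := hg n
    field_simp
    linarith
  rw [h2, div_div]
  have := (hg0 n).le
  gcongr

variable [IsProbabilityMeasure μ]

/-- Almost surely the number of white balls exceeds `h`. -/
theorem tendsto_white_lt (S : TriangularProcess μ c m h s W0 B0 W R F) :
    Tendsto (fun n => μ.real {ω | W n ω < h}) atTop (𝓝 0) := by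
  have hst : ∀ n ω, W n ω < h → W n ω = W0 := by
    intro n ω
    induction n with
    | zero => exact fun _ => S.white_zero ω
    | succ n ih =>
      intro hlt
      have h1 := S.dyn n ω
      rcases Nat.eq_zero_or_pos (R (n + 1) ω) with h0 | hpos
      · rw [h0, mul_zero, add_zero] at h1
        rw [h1] at hlt ⊢
        exact ih hlt
      · have : h * 1 ≤ h * R (n + 1) ω := Nat.mul_le_mul_left _ hpos
        omega
  have hw1 : (1 : ℝ) ≤ W0 := by exact_mod_cast S.one_le_white
  refine tendsto_zero_of_le_mul_one_sub_div (δ := W0 / (W0 + B0 + s + 0))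
    (n₀ := W0 + m + 2 * m * m) (by positivity) (fun n => measureReal_nonneg) fun n hn => ?_
  by_cases hWh : W0 < h
  swap
  · have : {ω | W (n + 1) ω < h} = ∅ := by
      ext ω
      simp only [mem_ofPred_eq, mem_empty_iff_false, iff_false]
      intro hlt
      have := hst _ ω hlt
      omega
    rw [this, measureReal_empty]
    have : {ω | W n ω < h} = ∅ := by
      ext ω
      simp only [mem_ofPred_eq, mem_empty_iff_false, iff_false]
      intro hlt
      have := hst _ ω hlt
      omega
    rw [this, measureReal_empty, zero_mul]
  have hsub : {ω | W (n + 1) ω < h} ⊆ univ ∩ {ω | W n ω = W0} ∩ {ω | R (n + 1) ω = 0} := by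
    intro ω hω
    have hω : W (n + 1) ω < h := hω
    have h1 := S.dyn n ω
    have h2 := S.white_mono ω (Nat.le_succ n)
    simp only at h2
    refine ⟨⟨mem_univ _, hst n ω (by omega)⟩, ?_⟩
    by_contra hne
    have : h * 1 ≤ h * R (n + 1) ω := Nat.mul_le_mul_left _ (Nat.pos_of_ne_zero hne)
    omega
  have heq : univ ∩ {ω | W n ω = W0} = {ω | W n ω < h} := by
    ext ω
    simp only [univ_inter, mem_ofPred_eq]
    exact ⟨fun h => h ▸ hWh, hst n ω⟩
  have hnt := S.one_le_total n
  refine (measureReal_mono hsub (measure_ne_top _ _)).trans ?_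
  rw [S.condLaw n univ MeasurableSet.univ W0 0 (Nat.zero_le _) (by omega), heq, mul_comm]
  refine mul_le_mul_of_nonneg_left ?_ measureReal_nonneg
  refine (S.weight_zero_le (by positivity) (by exact_mod_cast (by omega))
    (by exact_mod_cast (by omega))).1.trans ?_
  have := cast_total_add_le W0 B0 s n le_rfl
  have hT0 : (0 : ℝ) < (W0 + B0 + s * n : ℕ) := by exact_mod_cast (by omega)
  rw [div_div]
  gcongr
  linarith

/-- If `Λ = 1`, then almost surely the number of black balls exceeds `h`. -/
theorem tendsto_black_lt (S : TriangularProcess μ c m h s W0 B0 W R F) (hs : m * h = s) :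
    Tendsto (fun n => μ.real {ω | W0 + B0 + s * n < W n ω + h}) atTop (𝓝 0) := by
  have hdyn : ∀ n ω, W (n + 1) ω + h * (m - R (n + 1) ω) = W n ω + s := by
    intro n ω
    have h1 := S.dyn n ω
    have h2 : h * R (n + 1) ω + h * (m - R (n + 1) ω) = s := by
      rw [← mul_add, Nat.add_sub_cancel' (S.sample_le n ω), mul_comm, hs]
    omega
  have hst : ∀ n ω, W0 + B0 + s * n < W n ω + h → W n ω + B0 = W0 + B0 + s * n := by
    intro n ω
    induction n with
    | zero => intro _; rw [S.white_zero ω]; omega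
    | succ n ih =>
      intro hlt
      have h1 := hdyn n ω
      rw [mul_add] at hlt ⊢
      rcases Nat.eq_zero_or_pos (m - R (n + 1) ω) with h0 | hpos
      · rw [h0] at h1
        have := ih (by omega)
        omega
      · have : h * 1 ≤ h * (m - R (n + 1) ω) := Nat.mul_le_mul_left _ hpos
        have := S.le_total n ω
        omega
  have hb1 : (1 : ℝ) ≤ B0 := by exact_mod_cast S.one_le_black hs
  refine tendsto_zero_of_le_mul_one_sub_div (δ := B0 / (W0 + B0 + s + 0))
    (n₀ := B0 + m + 2 * m * m) (by positivity) (fun n => measureReal_nonneg) fun n hn => ?_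
  by_cases hBh : B0 < h
  swap
  · have hemp : ∀ n, {ω | W0 + B0 + s * n < W n ω + h} = ∅ := by
      intro n
      ext ω
      simp only [mem_ofPred_eq, mem_empty_iff_false, iff_false]
      intro hlt
      have := hst _ ω hlt
      omega
    rw [hemp, hemp, measureReal_empty, zero_mul]
  have hsub : {ω | W0 + B0 + s * (n + 1) < W (n + 1) ω + h} ⊆
      univ ∩ {ω | W n ω = W0 + s * n} ∩ {ω | R (n + 1) ω = m} := by
    intro ω hω
    have hω : W0 + B0 + s * (n + 1) < W (n + 1) ω + h := hω
    have h1 := hdyn n ω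
    have h2 := S.le_total n ω
    rw [mul_add] at hω
    have hR : m - R (n + 1) ω = 0 := by
      by_contra hne
      have : h * 1 ≤ h * (m - R (n + 1) ω) := Nat.mul_le_mul_left _ (Nat.pos_of_ne_zero hne)
      omega
    rw [hR] at h1
    have h3 := hst n ω (by omega)
    have h4 := S.sample_le n ω
    exact ⟨⟨mem_univ _, by simp only [mem_ofPred_eq]; omega⟩, by simp only [mem_ofPred_eq]; omega⟩
  have heq : univ ∩ {ω | W n ω = W0 + s * n} = {ω | W0 + B0 + s * n < W n ω + h} := by
    ext ω
    simp only [univ_inter, mem_ofPred_eq]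
    refine ⟨fun h => by omega, fun h => ?_⟩
    have := hst n ω h
    omega
  have hnt := S.one_le_total n
  refine (measureReal_mono hsub (measure_ne_top _ _)).trans ?_
  rw [S.condLaw n univ MeasurableSet.univ _ m le_rfl (by omega), heq, mul_comm]
  refine mul_le_mul_of_nonneg_left ?_ measureReal_nonneg
  have e : ((W0 + s * n : ℕ) : ℝ) = (W0 + B0 + s * n : ℕ) - (B0 : ℝ) := by push_cast; ring
  rw [e]
  refine (S.weight_zero_le (by positivity) (by exact_mod_cast (by omega))
    (by exact_mod_cast (by omega))).2.trans ?_
  have := cast_total_add_le W0 B0 s n le_rfl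
  have hT0 : (0 : ℝ) < (W0 + B0 + s * n : ℕ) := by exact_mod_cast (by omega)
  rw [div_div]
  gcongr
  linarith

/-- The largest point probability decays at the speed of the martingale normalisation. -/
theorem exists_point_bound (S : TriangularProcess μ c m h s W0 B0 W R F) {g : ℕ → ℝ}
    (hg0 : ∀ n, 0 < g n)
    (hg : ∀ n, g (n + 1) * ((W0 + B0 + s * n : ℕ) + m * h) = g n * (W0 + B0 + s * n : ℕ))
    {N : ℕ} {E : Set Ω} (hE : MeasurableSet[F N] E) (hw : ∀ ω ∈ E, h ≤ W N ω)
    (hb : m * h = s → ∀ ω ∈ E, W N ω + h ≤ W0 + B0 + s * N) :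
    ∃ K n₀, 0 ≤ K ∧ ∀ n, n₀ ≤ n → ∀ x, μ.real (E ∩ {ω | W n ω = x}) ≤ K * g n := by
  obtain ⟨C, n₀, hC0, -, hn₀, hC⟩ := S.exists_step_bound hE hw hb
  set D : ℝ := C * (1 + m * h) with hD
  have hD0 : 0 ≤ D := by positivity
  set H : ℕ → ℝ := fun n => ∑ i ∈ Finset.range n, 1 / (i : ℝ) ^ 2 with hH
  have hH0 : ∀ n, 0 ≤ H n := fun n => Finset.sum_nonneg fun i _ => by positivity
  have hHle : ∀ n, H n ≤ ∑' i : ℕ, 1 / (i : ℝ) ^ 2 := fun n =>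
    (Real.summable_one_div_nat_pow.2 (by norm_num)).sum_le_tsum _ fun i _ => by positivity
  have hmain : ∀ n, n₀ ≤ n → ∀ x,
      μ.real (E ∩ {ω | W n ω = x}) ≤ (g n₀)⁻¹ * g n * Real.exp (D * H n) := by
    intro n hn
    induction n, hn using Nat.le_induction with
    | base =>
      intro x
      rw [inv_mul_cancel₀ (hg0 _).ne', one_mul]
      exact measureReal_le_one.trans (Real.one_le_exp (mul_nonneg hD0 (hH0 _)))
    | succ n hn ih =>
      intro x
      set T : ℝ := ((W0 + B0 + s * n : ℕ) : ℝ) with hT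
      have hn1 : (1 : ℝ) ≤ n := by exact_mod_cast hn₀.trans hn
      have hTn : (n : ℝ) ≤ T := by
        have := S.one_le_total n
        exact Nat.cast_le.2 (by omega)
      have hT1 : 1 ≤ T := hn1.trans hTn
      have hT0 : 0 < T := by linarith
      set u : ℝ := (m : ℝ) * h with hu
      have hu0 : 0 ≤ u := by positivity
      have hgn := hg0 n
      have hgg : g n = g (n + 1) * ((T + u) / T) := by
        rw [← mul_div_assoc, hg n, mul_div_assoc, div_self hT0.ne', mul_one]
      have hnn : 0 ≤ (g n₀)⁻¹ * g n * Real.exp (D * H n) := by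
        have := (hg0 n₀).le
        positivity
      refine (hC n hn _ hnn ih x).trans ?_
      have e : H (n + 1) = H n + 1 / (n : ℝ) ^ 2 := Finset.sum_range_succ _ _
      have hfac : (T + u) / T * (1 - u / T + C / T ^ 2) ≤ Real.exp (D * (1 / (n : ℝ) ^ 2)) := by
        have h1 : (T + u) / T * (1 - u / T + C / T ^ 2)
            = 1 - (u / T) ^ 2 + C * (1 + u / T) / T ^ 2 := by
          field_simp
          ring
        have h2 : u / T ≤ u := div_le_self hu0 hT1
        have h3 : C * (1 + u / T) / T ^ 2 ≤ D * (1 / (n : ℝ) ^ 2) := by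
          rw [hD, ← mul_div_assoc, mul_one]
          gcongr
        have h4 := Real.add_one_le_exp (D * (1 / (n : ℝ) ^ 2))
        rw [h1]
        linarith [sq_nonneg (u / T)]
      rw [e, mul_add D, Real.exp_add]
      have hp : 0 ≤ (g n₀)⁻¹ * g (n + 1) * Real.exp (D * H n) := by
        have := (hg0 n₀).le
        have := (hg0 (n + 1)).le
        positivity
      calc _ = (g n₀)⁻¹ * g (n + 1) * Real.exp (D * H n) *
            ((T + u) / T * (1 - u / T + C / T ^ 2)) := by rw [hgg]; ring
        _ ≤ _ := mul_le_mul_of_nonneg_left hfac hp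
        _ = _ := by ring
  refine ⟨(g n₀)⁻¹ * Real.exp (D * ∑' i : ℕ, 1 / (i : ℝ) ^ 2), n₀, ?_, fun n hn x => ?_⟩
  · have := (hg0 n₀).le
    positivity
  · refine (hmain n hn x).trans ?_
    have h1 := (hg0 n₀).le
    have h2 := (hg0 n).le
    have h3 := hHle n
    rw [mul_right_comm]
    gcongr

end TriangularProcess

/-- A measure on the line that is bounded by a multiple of the length of intervals is bounded by
the same multiple of Lebesgue measure. -/
theorem measure_le_smul_volume {ν : Measure ℝ} {C : NNReal} (hC : C ≠ 0)
    (h : ∀ a b, a ≤ b → ν (Ioc a b) ≤ C * ENNReal.ofReal (b - a)) : ν ≤ C • volume := by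
  have hC' : (C : ENNReal) ≠ 0 := by simpa using hC
  have key : ((C : ENNReal)⁻¹ • ν).toOuterMeasure ≤ StieltjesFunction.id.outer := by
    refine OuterMeasure.le_ofFunction.2 fun s => ?_
    rw [StieltjesFunction.length_eq]
    refine le_iInf₂ fun a b => le_iInf fun hs => ?_
    have hs' : s ⊆ Ioc a b := fun x hx => hs ⟨hx, notMem_botSet_of_lt (sub_one_lt x)⟩
    change ((C : ENNReal)⁻¹ • ν) s ≤ ENNReal.ofReal (b - a)
    refine (measure_mono hs').trans ?_
    rw [Measure.smul_apply, smul_eq_mul]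
    rcases le_total a b with hab | hab
    · rw [ENNReal.inv_mul_le_iff hC' ENNReal.coe_ne_top]
      exact h a b hab
    · simp [Ioc_eq_empty hab.not_gt]
  refine Measure.le_iff.2 fun s hs => ?_
  have h1 : ((C : ENNReal)⁻¹ • ν) s ≤ volume s := by
    rw [Real.volume_eq_stieltjes_id, StieltjesFunction.measure]
    exact key s
  rw [Measure.smul_apply, smul_eq_mul, ENNReal.inv_mul_le_iff hC' ENNReal.coe_ne_top] at h1
  exact h1

/-- If the atoms of `X n` on `E` have mass at most `K * g n`, then the limit of `g n * X n`
charges an interval on `E` with at most `K` times its length. -/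
theorem measure_inter_Ioc_le {Ω : Type*} [MeasurableSpace Ω] {μ : Measure Ω}
    [IsProbabilityMeasure μ] {X : ℕ → Ω → ℕ} {g : ℕ → ℝ} {Y : Ω → ℝ} {E : Set Ω} {K : ℝ}
    {n₀ : ℕ} (hK : 0 ≤ K) (hg0 : ∀ n, 0 < g n) (hg : Tendsto g atTop (𝓝 0))
    (hE : ∀ n ≥ n₀, ∀ x, μ.real (E ∩ {ω | X n ω = x}) ≤ K * g n)
    (hY : ∀ᵐ ω ∂μ, Tendsto (fun n => g n * (X n ω : ℝ)) atTop (𝓝 (Y ω))) {a b : ℝ}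
    (hab : a ≤ b) : μ.real (E ∩ Y ⁻¹' Ioc a b) ≤ K * (b - a) := by
  have hopen : ∀ β, b < β → μ.real (E ∩ Y ⁻¹' Ioc a b) ≤ K * (β - a) := by
    intro β hβ
    set A : ℕ → Set Ω := fun n => E ∩ {ω | g n * (X n ω : ℝ) ∈ Ioo a β} with hA
    have hstep : ∀ n ≥ n₀, μ.real (A n) ≤ K * (β - a) + K * g n := by
      intro n hn
      have hgn := hg0 n
      set I : Finset ℤ := Finset.Icc (⌊a / g n⌋ + 1) (⌈β / g n⌉ - 1) with hI
      have hsub : A n ⊆ ⋃ i ∈ I, (E ∩ {ω | X n ω = i.toNat}) := by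
        rintro ω ⟨h1, h2, h3⟩
        simp only [mem_iUnion]
        refine ⟨X n ω, ?_, h1, by simp⟩
        rw [hI, Finset.mem_Icc, Int.add_one_le_iff, Int.le_sub_one_iff, Int.floor_lt, Int.lt_ceil,
          div_lt_iff₀ hgn, lt_div_iff₀ hgn]
        constructor <;> push_cast <;> linarith
      have hcard : (I.card : ℝ) ≤ (β - a) / g n + 1 := by
        have hnn : 0 ≤ (β - a) / g n := div_nonneg (by linarith) hgn.le
        have h1 := Int.sub_one_lt_floor (a / g n)
        have h2 := Int.ceil_lt_add_one (β / g n)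
        rw [hI, Int.card_Icc]
        have h3 : (((⌈β / g n⌉ - 1 + 1 - (⌊a / g n⌋ + 1)).toNat : ℕ) : ℝ)
            = ((max (⌈β / g n⌉ - 1 + 1 - (⌊a / g n⌋ + 1)) 0 : ℤ) : ℝ) := by
          exact_mod_cast congrArg (fun z : ℤ => (z : ℝ)) (Int.toNat_eq_max _)
        rw [h3]
        push_cast
        refine max_le ?_ (by linarith)
        rw [sub_div]
        linarith
      calc μ.real (A n) ≤ μ.real (⋃ i ∈ I, (E ∩ {ω | X n ω = i.toNat})) :=
            measureReal_mono hsub (measure_ne_top _ _)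
        _ ≤ ∑ i ∈ I, μ.real (E ∩ {ω | X n ω = i.toNat}) := measureReal_biUnion_finset_le _ _
        _ ≤ ∑ _i ∈ I, K * g n := Finset.sum_le_sum fun i _ => hE n hn _
        _ = I.card * (K * g n) := by rw [Finset.sum_const, nsmul_eq_mul]
        _ ≤ ((β - a) / g n + 1) * (K * g n) := by gcongr
        _ = K * (β - a) + K * g n := by field_simp
    set D : ℕ → Set Ω := fun N => ⋂ n ≥ N, A n with hD
    have hmono : Monotone D := fun i j hij => biInter_subset_biInter_left fun n hn => hij.trans hn
    have hDle : ∀ N, μ.real (D N) ≤ K * (β - a) := by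
      intro N
      have hlim : Tendsto (fun n => K * (β - a) + K * g n) atTop (𝓝 (K * (β - a))) := by
        simpa using (hg.const_mul K).const_add (K * (β - a))
      refine ge_of_tendsto hlim ?_
      filter_upwards [eventually_ge_atTop N, eventually_ge_atTop n₀] with n h1 h2
      exact (measureReal_mono (biInter_subset_of_mem h1)).trans (hstep n h2)
    have hae : (E ∩ Y ⁻¹' Ioc a b : Set Ω) ≤ᵐ[μ] (⋃ N, D N : Set Ω) := by
      filter_upwards [hY] with ω hω hm
      obtain ⟨h1, h2, h3⟩ := hm
      obtain ⟨N, hN⟩ := eventually_atTop.1 (hω.eventually (Ioo_mem_nhds h2 (h3.trans_lt hβ)))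
      exact mem_iUnion.2 ⟨N, mem_iInter₂.2 fun n hn => ⟨h1, hN n hn⟩⟩
    have hle : μ (E ∩ Y ⁻¹' Ioc a b) ≤ ENNReal.ofReal (K * (β - a)) := by
      refine (measure_mono_ae hae).trans ?_
      rw [hmono.measure_iUnion]
      exact iSup_le fun N => (ENNReal.le_ofReal_iff_toReal_le (measure_ne_top _ _)
        (mul_nonneg hK (by linarith))).2 (hDle N)
    exact ENNReal.toReal_le_of_le_ofReal (mul_nonneg hK (by linarith)) hle
  have hlim : Tendsto (fun β => K * (β - a)) (𝓝[>] b) (𝓝 (K * (b - a))) :=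
    ((continuous_const.mul (continuous_id.sub continuous_const)).tendsto b).mono_left
      nhdsWithin_le_nhds
  exact ge_of_tendsto hlim (eventually_mem_nhdsWithin.mono hopen)

namespace TriangularProcess

variable {Ω : Type*} [m0 : MeasurableSpace Ω] {μ : Measure Ω} [IsProbabilityMeasure μ] {c : ℝ}
  {m h s W0 B0 : ℕ} {W R : ℕ → Ω → ℕ} {F : Filtration ℕ m0}

theorem exists_map_restrict_le (S : TriangularProcess μ c m h s W0 B0 W R F) {g : ℕ → ℝ}
    (hg0 : ∀ n, 0 < g n)
    (hg : ∀ n, g (n + 1) * (((W0 + B0 + s * n : ℕ) : ℝ) + m * h)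
      = g n * ((W0 + B0 + s * n : ℕ) : ℝ))
    {Y : Ω → ℝ} (hYm : Measurable Y)
    (hY : ∀ᵐ ω ∂μ, Tendsto (fun n => g n * (W n ω : ℝ)) atTop (𝓝 (Y ω)))
    {E : Set Ω} {N : ℕ} (hE : MeasurableSet[F N] E) (hw : ∀ ω ∈ E, h ≤ W N ω)
    (hb : m * h = s → ∀ ω ∈ E, W N ω + h ≤ W0 + B0 + s * N) :
    ∃ C : NNReal, (μ.restrict E).map Y ≤ C • volume := by
  obtain ⟨K, n₀, hK, hpt⟩ := S.exists_point_bound hg0 hg hE hw hb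
  refine ⟨⟨K, hK⟩ + 1, measure_le_smul_volume (by positivity) fun a b hab => ?_⟩
  rw [Measure.map_apply hYm measurableSet_Ioc, Measure.restrict_apply (hYm measurableSet_Ioc),
    inter_comm]
  have h1 := measure_inter_Ioc_le hK hg0 (S.tendsto_normalisation hg0 hg) hpt hY hab
  have h2 := (ENNReal.le_ofReal_iff_toReal_le (measure_ne_top μ _)
    (mul_nonneg hK (sub_nonneg.2 hab))).2 h1
  rw [ENNReal.ofReal_mul hK] at h2
  refine h2.trans (mul_le_mul_left ?_ _)
  rw [ENNReal.ofReal_eq_coe_nnreal hK, ENNReal.coe_le_coe]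
  exact le_self_add

theorem map_absolutelyContinuous (S : TriangularProcess μ c m h s W0 B0 W R F) {g : ℕ → ℝ}
    (hg0 : ∀ n, 0 < g n)
    (hg : ∀ n, g (n + 1) * (((W0 + B0 + s * n : ℕ) : ℝ) + m * h)
      = g n * ((W0 + B0 + s * n : ℕ) : ℝ))
    {Y : Ω → ℝ} (hYm : Measurable Y)
    (hY : ∀ᵐ ω ∂μ, Tendsto (fun n => g n * (W n ω : ℝ)) atTop (𝓝 (Y ω))) :
    μ.map Y ≪ volume := by
  refine Measure.AbsolutelyContinuous.mk fun A hA hA0 => ?_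
  rw [Measure.map_apply hYm hA]
  set V : ℕ → Set ℕ := fun N => {x | h ≤ x ∧ (m * h = s → x + h ≤ W0 + B0 + s * N)} with hV
  have hbound : ∀ N, μ.real (Y ⁻¹' A) ≤ μ.real {ω | W N ω ∉ V N} := by
    intro N
    obtain ⟨C, hC⟩ := S.exists_map_restrict_le hg0 hg hYm hY (E := W N ⁻¹' V N) (N := N)
      (S.measurable_white N trivial) (fun ω hω => hω.1) (fun hs ω hω => hω.2 hs)
    have h0 : μ (Y ⁻¹' A ∩ W N ⁻¹' V N) = 0 := by
      rw [← Measure.restrict_apply (hYm hA), ← Measure.map_apply hYm hA]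
      refine le_antisymm ((hC A).trans ?_) zero_le
      simp [hA0]
    have h1 : μ (Y ⁻¹' A) ≤ μ {ω | W N ω ∉ V N} := by
      calc μ (Y ⁻¹' A) ≤ μ (Y ⁻¹' A ∩ W N ⁻¹' V N) + μ (Y ⁻¹' A \ W N ⁻¹' V N) :=
            measure_le_inter_add_sdiff _ _ _
        _ ≤ _ := by
            rw [h0, zero_add]
            exact measure_mono fun ω hω => hω.2
    exact ENNReal.toReal_mono (measure_ne_top _ _) h1
  have hlim : Tendsto (fun N => μ.real {ω | W N ω ∉ V N}) atTop (𝓝 0) := by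
    by_cases hs : m * h = s
    · have := S.tendsto_white_lt.add (S.tendsto_black_lt hs)
      rw [add_zero] at this
      refine squeeze_zero (fun _ => measureReal_nonneg) (fun N => ?_) this
      refine (measureReal_mono ?_).trans (measureReal_union_le _ _)
      intro ω hω
      simp only [hV, mem_ofPred_eq, not_and_or, Classical.not_imp, not_le] at hω
      exact hω.imp id And.right
    · refine squeeze_zero (fun _ => measureReal_nonneg) (fun N => measureReal_mono ?_)
        S.tendsto_white_lt
      intro ω hω
      simpa [hV, hs] using hω
  have h2 : μ.real (Y ⁻¹' A) ≤ 0 := ge_of_tendsto hlim (Eventually.of_forall hbound)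
  exact (measureReal_eq_zero_iff).1 (le_antisymm h2 measureReal_nonneg)

end TriangularProcess

/-- An absolutely continuous probability measure on `[0, ∞)` has a nonnegative density vanishing on
`(-∞, 0]`, bounded if the measure is bounded by a multiple of Lebesgue measure. -/
theorem exists_density_of_absolutelyContinuous {ν : Measure ℝ} [IsProbabilityMeasure ν]
    (hac : ν ≪ volume) (hnn : ν (Iio 0) = 0) :
    ∃ f : ℝ → ℝ, (∀ x, 0 ≤ f x) ∧ (∀ x, x ≤ 0 → f x = 0) ∧
      ν = (volume.withDensity fun x => ENNReal.ofReal (f x)) ∧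
      ((∃ C : NNReal, ν ≤ C • volume) → ∃ K : ℝ, ∀ x, f x ≤ K) := by
  have hIic : ∀ᵐ x ∂ν, x ∉ Iic (0 : ℝ) := by
    rw [← measure_eq_zero_iff_ae_notMem, ← Iio_union_right]
    exact measure_union_null hnn (hac (by simp))
  have key : ∀ f : ℝ → ENNReal, f =ᵐ[volume] ν.rnDeriv volume →
      ν = volume.withDensity fun x =>
        ENNReal.ofReal ((Ioi 0).indicator (fun x => (f x).toReal) x) := by
    intro f hf
    have h1 : ν = ν.restrict (Ioi 0) := by
      refine (Measure.restrict_eq_self_of_ae_mem ?_).symm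
      filter_upwards [hIic] with x hx
      simpa using hx
    have h2 : volume.withDensity (ν.rnDeriv volume) = ν := Measure.withDensity_rnDeriv_eq _ _ hac
    conv_lhs => rw [h1, ← h2, restrict_withDensity measurableSet_Ioi,
      ← withDensity_indicator measurableSet_Ioi]
    refine withDensity_congr_ae ?_
    filter_upwards [hf, Measure.rnDeriv_lt_top ν volume] with x hx hlt
    by_cases h0 : x ∈ Ioi (0 : ℝ)
    · simp only [indicator_of_mem h0]
      rw [hx, ENNReal.ofReal_toReal hlt.ne]
    · simp [indicator_of_notMem h0]
  by_cases hb : ∃ C : NNReal, ν ≤ C • volume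
  · obtain ⟨C, hC⟩ := hb
    have hle : ν.rnDeriv volume ≤ᵐ[volume] fun _ => (C : ENNReal) := by
      refine ae_le_of_forall_setLIntegral_le_of_sigmaFinite (Measure.measurable_rnDeriv _ _)
        fun A hA _ => ?_
      rw [setLIntegral_const]
      exact (Measure.setLIntegral_rnDeriv_le A).trans (hC A)
    refine ⟨(Ioi 0).indicator fun x => (min (ν.rnDeriv volume x) C).toReal,
      fun x => indicator_nonneg (fun _ _ => ENNReal.toReal_nonneg) x,
      fun x hx => indicator_of_notMem (by simpa using hx) _, key _ ?_, fun _ => ⟨C, fun x => ?_⟩⟩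
    · filter_upwards [hle] with x hx using min_eq_left hx
    · refine indicator_le' (fun x _ => ?_) (fun _ _ => C.2) x
      exact ENNReal.toReal_le_coe_of_le_coe (min_le_right _ _)
  · exact ⟨(Ioi 0).indicator fun x => (ν.rnDeriv volume x).toReal,
      fun x => indicator_nonneg (fun _ _ => ENNReal.toReal_nonneg) x,
      fun x hx => indicator_of_notMem (by simpa using hx) _, key _ (ae_eq_refl _),
      fun h => absurd h hb⟩

theorem stepFactorial_zero_left (k : ℕ) (x : ℝ) : stepFactorial 0 k x = x ^ k := by
  simp [stepFactorial]

theorem stepFactorial_one_natCast (k w : ℕ) :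
    stepFactorial 1 k (w : ℝ) = (k.factorial : ℝ) * (w.choose k : ℝ) := by
  rw [← Nat.cast_mul, ← Nat.descFactorial_eq_factorial_mul_choose]
  induction k with
  | zero => simp [stepFactorial]
  | succ k ih =>
    have h : stepFactorial 1 (k + 1) (w : ℝ) = stepFactorial 1 k (w : ℝ) * (w - k) := by
      simp [stepFactorial, Finset.prod_range_succ]
    rw [h, ih, Nat.descFactorial_succ]
    rcases le_or_gt k w with hk | hk
    · rw [Nat.cast_mul, Nat.cast_sub hk, mul_comm]
    · simp [Nat.descFactorial_eq_zero_iff_lt.2 hk]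

theorem samplingWeight_eq_sampleProb (mdlM : Bool) {m j : ℕ} (hj : j ≤ m) (w b : ℕ) :
    samplingWeight (if mdlM then 1 else 0) m j (w : ℝ) ((w + b : ℕ) : ℝ)
      = if mdlM then sampleProbM m j w b else sampleProbR m j w b := by
  have hb : ((w + b : ℕ) : ℝ) - w = b := by push_cast; ring
  unfold samplingWeight
  cases mdlM
  · simp only [Bool.false_eq_true, if_false, hb, stepFactorial_zero_left, sampleProbR]
    push_cast
    ring
  · simp only [if_true, hb, stepFactorial_one_natCast, sampleProbM]
    have h1 : (m.choose j : ℝ) * j.factorial * (m - j).factorial = m.factorial := by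
      exact_mod_cast Nat.choose_mul_factorial_mul_factorial hj
    have h2 : (m.factorial : ℝ) ≠ 0 := by exact_mod_cast m.factorial_ne_zero
    rw [← mul_div_mul_left (w.choose j * b.choose (m - j) : ℝ) _ h2]
    congr 1
    rw [← h1]
    ring

namespace UrnScheme

variable {Ω : Type*} [m0 : MeasurableSpace Ω] {μ : Measure Ω} {mdlM : Bool} {m h s : ℕ}
  {a b : ℕ → ℤ} {σ : ℤ} {W0 B0 : ℕ} {W B R : ℕ → Ω → ℕ} {F : Filtration ℕ m0}

theorem white_add_black (U : UrnScheme μ mdlM m a b (s : ℤ) W0 B0 W B R F) (n : ℕ) (ω : Ω) :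
    W n ω + B n ω = W0 + B0 + s * n := by
  induction n with
  | zero => simp [U.initW ω, U.initB ω]
  | succ n ih =>
    have h1 := U.dynW n ω
    have h2 := U.dynB n ω
    have h3 := U.balanced (m - R (n + 1) ω) (Nat.sub_le _ _)
    rw [mul_add]
    omega

theorem triangularProcess [IsProbabilityMeasure μ]
    (U : UrnScheme μ mdlM m a b (s : ℤ) W0 B0 W B R F) (ham : a m = 0) (hah : a (m - 1) = h)
    (hh : 1 ≤ h) (hhs : m * h ≤ s) (hW0 : 1 ≤ W0) (hB0 : m * h = s → 1 ≤ B0) :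
    TriangularProcess μ (if mdlM then 1 else 0) m h s W0 B0 W R F where
  one_le_m := U.hm
  one_le_h := hh
  mul_le := hhs
  one_le_white := hW0
  one_le_black := hB0
  c_nonneg := by split_ifs <;> norm_num
  c_le_one := by split_ifs <;> norm_num
  white_zero := U.initW
  dyn n ω := by
    have h1 := U.dynW n ω
    have h2 := U.sampleLe n ω
    rw [U.affine _ (Nat.sub_le _ _), ham, hah, Nat.cast_sub h2] at h1
    have h3 : (W (n + 1) ω : ℤ) = ((W n ω + h * R (n + 1) ω : ℕ) : ℤ) := by
      rw [h1]; push_cast; ring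
    exact_mod_cast h3
  sample_le := U.sampleLe
  le_total n ω := (Nat.le_add_right _ _).trans (U.white_add_black n ω).le
  measurable_white := U.measW
  weight_nonneg n j y hj hy := by
    obtain ⟨z, hz⟩ := Nat.exists_eq_add_of_le hy
    rw [hz, samplingWeight_eq_sampleProb mdlM hj]
    unfold sampleProbM sampleProbR
    split_ifs <;> positivity
  condLaw n E hE y j hj hy := by
    obtain ⟨z, hz⟩ := Nat.exists_eq_add_of_le hy
    rw [hz, samplingWeight_eq_sampleProb mdlM hj]
    set A := E ∩ {ω | W n ω = y}
    have hA : MeasurableSet[F n] A := hE.inter (U.measW n (measurableSet_singleton y))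
    have hRm : MeasurableSet {ω | R (n + 1) ω = j} :=
      F.le _ _ (U.measR n (measurableSet_singleton j))
    have hRint : Integrable (({ω | R (n + 1) ω = j}).indicator fun _ => (1 : ℝ)) μ :=
      (integrable_const 1).indicator hRm
    have h1 := setIntegral_condExp (F.le n) hRint hA
    rw [setIntegral_indicator hRm, setIntegral_const, smul_eq_mul, mul_one] at h1
    rw [← h1]
    have h2 : ∀ᵐ ω ∂μ, ω ∈ A →
        (μ[(({ω | R (n + 1) ω = j}).indicator fun _ => (1 : ℝ)) | F n]) ω
          = if mdlM then sampleProbM m j y z else sampleProbR m j y z := by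
      filter_upwards [U.condLaw n j hj] with ω hω hmem
      have hy' : W n ω = y := hmem.2
      have hz' : B n ω = z := by
        have := U.white_add_black n ω
        omega
      rw [hω, hy', hz']
    rw [setIntegral_congr_ae (F.le n _ hA) h2, setIntegral_const, smul_eq_mul, mul_comm]

end UrnScheme

theorem urnG_pos {T0 : ℕ} {σ : ℤ} {Λ : ℝ} (hT : 1 ≤ T0) (hσ : 1 ≤ σ) (hΛ : 0 < Λ) (n : ℕ) :
    0 < urnG T0 σ Λ n := by
  have h1 : (0 : ℝ) < T0 / σ := div_pos (by exact_mod_cast hT) (by exact_mod_cast hσ)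
  have h2 : (0 : ℝ) ≤ n := n.cast_nonneg
  unfold urnG urnQ
  have := Real.Gamma_pos_of_pos h1
  have := Real.Gamma_pos_of_pos (add_pos h1 hΛ)
  have := Real.Gamma_pos_of_pos (add_pos_of_nonneg_of_pos h2 h1)
  have := Real.Gamma_pos_of_pos (add_pos (add_pos_of_nonneg_of_pos h2 h1) hΛ)
  positivity

theorem urnG_succ {T0 : ℕ} {σ : ℤ} {Λ : ℝ} (hT : 1 ≤ T0) (hσ : 1 ≤ σ) (hΛ : 0 < Λ) (n : ℕ) :
    urnG T0 σ Λ (n + 1) * (T0 + σ * n + σ * Λ) = urnG T0 σ Λ n * (T0 + σ * n) := by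
  have hσ0 : (0 : ℝ) < σ := by exact_mod_cast hσ
  have h1 : (0 : ℝ) < T0 / σ := div_pos (by exact_mod_cast hT) hσ0
  have h2 : (0 : ℝ) < n + T0 / σ := add_pos_of_nonneg_of_pos n.cast_nonneg h1
  have h3 : (0 : ℝ) < n + T0 / σ + Λ := add_pos h2 hΛ
  have h4 := Real.Gamma_pos_of_pos h3
  have e1 : (((n + 1 : ℕ) : ℝ) + T0 / σ) = (n + T0 / σ) + 1 := by push_cast; ring
  have e2 : (n : ℝ) + T0 / σ + 1 + Λ = (n + T0 / σ + Λ) + 1 := by ring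
  have e3 : (T0 + σ * n + σ * Λ : ℝ) = σ * (n + T0 / σ + Λ) := by field_simp; ring
  have e4 : (T0 + σ * n : ℝ) = σ * (n + T0 / σ) := by field_simp; ring
  unfold urnG
  rw [e1, e2, Real.Gamma_add_one h2.ne', Real.Gamma_add_one h3.ne', e3, e4]
  field_simp

/-- The limit `𝔚_∞` of the martingale `𝔚_n = g_n W_n` in a triangular urn
admits a density on `(0,∞)`, which is bounded if `W₀ ≥ a_{m-1}` (for `Λ < 1`) resp.
`W₀, B₀ ≥ a_{m-1}` (for `Λ = 1`). -/
theorem triangular_density {Ω : Type*} [m0 : MeasurableSpace Ω] (μ : Measure Ω)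
    [IsProbabilityMeasure μ] (mdlM : Bool) (m : ℕ) (a b : ℕ → ℤ) (σ : ℤ) (W0 B0 : ℕ)
    (W B : ℕ → Ω → ℕ) (R : ℕ → Ω → ℕ) (F : Filtration ℕ m0)
    (hurn : UrnScheme μ mdlM m a b σ W0 B0 W B R F)
    (ham : a m = 0) (hΛlo : 0 < urnIndex m a σ) (hΛhi : urnIndex m a σ ≤ 1)
    (hW0 : 1 ≤ W0) (hB0 : urnIndex m a σ = 1 → 1 ≤ B0)
    (Winf : Ω → ℝ) (hmeas : Measurable Winf)
    (hWinf : ∀ᵐ ω ∂μ, Tendsto (fun n : ℕ => frakW σ (urnIndex m a σ) (W0 + B0) W n ω)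
      atTop (𝓝 (Winf ω))) :
    μ.map Winf ≪ volume ∧
    ∃ f : ℝ → ℝ, (∀ x, 0 ≤ f x) ∧ (∀ x, x ≤ 0 → f x = 0) ∧
      μ.map Winf = (volume.withDensity fun x => ENNReal.ofReal (f x)) ∧
      (((urnIndex m a σ < 1 ∧ a (m - 1) ≤ (W0 : ℤ)) ∨
        (urnIndex m a σ = 1 ∧ a (m - 1) ≤ (W0 : ℤ) ∧ a (m - 1) ≤ (B0 : ℤ))) →
        ∃ K : ℝ, ∀ x, f x ≤ K) := by
  have hσ := hurn.hσ
  obtain ⟨s, rfl⟩ := Int.eq_ofNat_of_zero_le (zero_le_one.trans hσ)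
  have hs0 : (0 : ℝ) < (s : ℤ) := by exact_mod_cast hσ
  have hm0 : (0 : ℝ) < m := by exact_mod_cast hurn.hm
  have hidx : urnIndex m a s = m * (a (m - 1) : ℝ) / (s : ℤ) := by simp [urnIndex, ham]
  have hapos : 0 < a (m - 1) := by
    rw [hidx, div_pos_iff_of_pos_right hs0, mul_pos_iff_of_pos_left hm0] at hΛlo
    exact_mod_cast hΛlo
  obtain ⟨h, hah⟩ := Int.eq_ofNat_of_zero_le hapos.le
  rw [hah] at hapos
  have hidx' : ((s : ℤ) : ℝ) * urnIndex m a s = m * h := by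
    rw [hidx, hah, mul_div_cancel₀ _ hs0.ne']
    simp
  have hone : urnIndex m a s = 1 ↔ m * h = s := by
    rw [← mul_right_inj' hs0.ne', hidx', mul_one]
    norm_cast
  have hle : m * h ≤ s := by
    have := mul_le_mul_of_nonneg_left hΛhi hs0.le
    rw [hidx', mul_one] at this
    exact_mod_cast this
  have S := hurn.triangularProcess ham hah (by omega) hle hW0 fun e => hB0 (hone.2 e)
  have hg0 := urnG_pos (T0 := W0 + B0) (by omega) hσ hΛlo
  have hg : ∀ n, urnG (W0 + B0) s (urnIndex m a s) (n + 1) *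
      (((W0 + B0 + s * n : ℕ) : ℝ) + m * h)
        = urnG (W0 + B0) s (urnIndex m a s) n * ((W0 + B0 + s * n : ℕ) : ℝ) := by
    intro n
    have := urnG_succ (T0 := W0 + B0) (by omega) hσ hΛlo n
    rw [hidx'] at this
    exact_mod_cast this
  have hac := S.map_absolutelyContinuous hg0 hg hmeas hWinf
  have hprob : IsProbabilityMeasure (μ.map Winf) :=
    Measure.isProbabilityMeasure_map hmeas.aemeasurable
  have hnn : μ.map Winf (Iio 0) = 0 := by
    rw [Measure.map_apply hmeas measurableSet_Iio, measure_eq_zero_iff_ae_notMem]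
    filter_upwards [hWinf] with ω hω
    exact not_lt.2 (ge_of_tendsto' hω fun n => mul_nonneg (hg0 n).le (Nat.cast_nonneg _))
  obtain ⟨f, hf0, hfneg, hf, hfb⟩ := exists_density_of_absolutelyContinuous hac hnn
  refine ⟨hac, f, hf0, hfneg, hf, fun hcase => hfb ?_⟩
  have hW : h ≤ W0 := by
    rw [hah] at hcase
    omega
  have hB : m * h = s → h ≤ B0 := by
    intro e
    rcases hcase with ⟨h1, -⟩ | ⟨-, -, h1⟩
    · exact absurd (hone.2 e) h1.ne
    · omega
  have := S.exists_map_restrict_le hg0 hg hmeas hWinf (E := univ) (N := 0) MeasurableSet.univ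
    (fun ω _ => by rw [S.white_zero]; exact hW) (fun e ω _ => by
      have := hB e
      rw [S.white_zero]
      omega)
  rwa [Measure.restrict_univ] at this
end
end

section
/- Let W_n be the number of white balls at time n in a triangular urn (model M or model R) with 0 < Λ ≤ 1 and a_m = 0, and let 𝔚_∞ be the almost sure limit of the martingale 𝔚_n := g_n·W_n. If Λ > 1/2, then 𝔚_∞ is Subgaussian (there exist c, C > 0 with P(|𝔚_∞| ≥ t) ≤ C·e^{−ct²} for all t > 0), and for Λ = 1 moreover 𝔚_∞ ≤ T_0 almost surely. If Λ ≤ 1/2, then the moment-generating function t ↦ E[e^{t·𝔚_∞}] is finite for all t in some non-empty open interval containing zero. -/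
open MeasureTheory ProbabilityTheory Filter Set Topology

noncomputable section

lemma one_add_mul_exp_sub_one_le_exp_mul {x u : ℝ} (hx : 0 ≤ x) (hu0 : 0 ≤ u) (hu1 : u ≤ 1) :
    1 + x * (Real.exp u - 1) ≤ Real.exp (x * (u + u ^ 2)) := by
  have h1 := (abs_le.1 (Real.abs_exp_sub_one_sub_id_le (abs_le.2 ⟨by linarith, hu1⟩))).2
  have h2 := Real.add_one_le_exp (x * (u + u ^ 2))
  nlinarith [mul_le_mul_of_nonneg_left h1 hx]

lemma one_add_mul_exp_sub_one_le {x u : ℝ} (hx0 : 0 ≤ x) (hx1 : x ≤ 1) (hu : 0 ≤ u) :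
    1 + x * (Real.exp u - 1) ≤ Real.exp (x * u + u ^ 2) := by
  rcases le_total u 1 with h | h
  · refine (one_add_mul_exp_sub_one_le_exp_mul hx0 hu h).trans (Real.exp_le_exp.2 ?_)
    nlinarith [sq_nonneg u]
  · have h1 := Real.one_le_exp hu
    calc 1 + x * (Real.exp u - 1) ≤ Real.exp u := by nlinarith
      _ ≤ Real.exp (x * u + u ^ 2) := Real.exp_le_exp.2 (by nlinarith [mul_nonneg hx0 hu])

/-- Fatou's lemma for nonnegative integrable functions with bounded integrals. -/
lemma integrable_and_integral_le_of_tendsto_ae {α : Type*} [MeasurableSpace α] {μ : Measure α}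
    {f : ℕ → α → ℝ} {g : α → ℝ} {K : ℝ} (hf : ∀ n, Integrable (f n) μ) (hf0 : ∀ n x, 0 ≤ f n x)
    (hK : ∀ n, ∫ x, f n x ∂μ ≤ K)
    (hlim : ∀ᵐ x ∂μ, Tendsto (fun n => f n x) atTop (𝓝 (g x))) :
    Integrable g μ ∧ ∫ x, g x ∂μ ≤ K := by
  have hmeas : AEStronglyMeasurable g μ :=
    aestronglyMeasurable_of_tendsto_ae atTop (fun n => (hf n).aestronglyMeasurable) hlim
  have hg0 : 0 ≤ᵐ[μ] g := by
    filter_upwards [hlim] with x hx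
    exact ge_of_tendsto' hx fun n => hf0 n x
  have hK0 : 0 ≤ K := (integral_nonneg (hf0 0)).trans (hK 0)
  have hfatou : ∫⁻ x, ENNReal.ofReal (g x) ∂μ ≤ ENNReal.ofReal K := by
    calc ∫⁻ x, ENNReal.ofReal (g x) ∂μ
        = ∫⁻ x, liminf (fun n => ENNReal.ofReal (f n x)) atTop ∂μ := by
          refine lintegral_congr_ae ?_
          filter_upwards [hlim] with x hx
          exact ((ENNReal.continuous_ofReal.tendsto _).comp hx).liminf_eq.symm
      _ ≤ liminf (fun n => ∫⁻ x, ENNReal.ofReal (f n x) ∂μ) atTop :=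
          lintegral_liminf_le' fun n => (hf n).aemeasurable.ennreal_ofReal
      _ ≤ ENNReal.ofReal K := by
          refine liminf_le_of_frequently_le' (Frequently.of_forall fun n => ?_)
          rw [← ofReal_integral_eq_lintegral_ofReal (hf n) (ae_of_all _ (hf0 n))]
          exact ENNReal.ofReal_le_ofReal (hK n)
  refine ⟨⟨hmeas, ?_⟩, ?_⟩
  · rw [hasFiniteIntegral_iff_ofReal hg0]
    exact hfatou.trans_lt ENNReal.ofReal_lt_top
  · rw [integral_eq_lintegral_of_nonneg_ae hg0 hmeas]
    exact ENNReal.toReal_le_of_le_ofReal hK0 hfatou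

lemma Nat.choose_mul_pow_le {w t : ℕ} (hwt : w ≤ t) (j : ℕ) :
    w.choose j * t ^ j ≤ t.choose j * w ^ j := by
  have key : ∀ j : ℕ, w.descFactorial j * t ^ j ≤ t.descFactorial j * w ^ j := by
    intro j
    induction j with
    | zero => simp
    | succ j ih =>
      have h : (w - j) * t ≤ (t - j) * w := by
        rw [Nat.sub_mul, Nat.sub_mul, Nat.mul_comm w t]
        exact Nat.sub_le_sub_left (Nat.mul_le_mul_left j hwt) _
      calc w.descFactorial (j + 1) * t ^ (j + 1)
          = ((w - j) * t) * (w.descFactorial j * t ^ j) := by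
            rw [Nat.descFactorial_succ]; ring
        _ ≤ ((t - j) * w) * (t.descFactorial j * w ^ j) := Nat.mul_le_mul h ih
        _ = t.descFactorial (j + 1) * w ^ (j + 1) := by
            rw [Nat.descFactorial_succ]; ring
  have h := key j
  rw [Nat.descFactorial_eq_factorial_mul_choose, Nat.descFactorial_eq_factorial_mul_choose,
    mul_assoc, mul_assoc] at h
  exact Nat.le_of_mul_le_mul_left h j.factorial_pos

/-- Factorial moments of the hypergeometric distribution. -/
lemma sum_choose_mul_choose_mul_choose (m w b j : ℕ) (hj : j ≤ m) :
    ∑ k ∈ Finset.range (m + 1), w.choose k * b.choose (m - k) * k.choose j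
      = w.choose j * (w - j + b).choose (m - j) := by
  rw [Nat.add_choose_eq, Finset.Nat.sum_antidiagonal_eq_sum_range_succ_mk, Finset.mul_sum,
    ← Finset.sum_subset (s₁ := Finset.Ico j (m + 1)), Finset.sum_Ico_eq_sum_range]
  · have h : m + 1 - j = (m - j).succ := by omega
    rw [h]
    refine Finset.sum_congr rfl fun i hi => ?_
    have h1 := Nat.choose_mul (n := w) (k := j + i) (s := j) (by omega)
    rw [Nat.add_sub_cancel_left] at h1
    have h2 : m - (j + i) = m - j - i := by omega
    simp only [h2]
    linear_combination (b.choose (m - j - i)) * h1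
  · intro k hk
    simp only [Finset.mem_Ico, Finset.mem_range] at *
    omega
  · intro k hk hk'
    simp only [Finset.mem_Ico, Finset.mem_range] at *
    rw [Nat.choose_eq_zero_of_lt (show k < j by omega), mul_zero]

lemma sum_pow_mul_sampleProbR (m w b : ℕ) (hT : 0 < w + b) (z : ℝ) :
    ∑ k ∈ Finset.range (m + 1), z ^ k * sampleProbR m k w b
      = (1 + (w : ℝ) / ((w : ℝ) + b) * (z - 1)) ^ m := by
  have hT' : (0 : ℝ) < (w : ℝ) + b := by exact_mod_cast hT
  have h : 1 + (w : ℝ) / ((w : ℝ) + b) * (z - 1) = (w * z + b) / ((w : ℝ) + b) := by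
    field_simp
    ring
  rw [h, div_pow, add_pow, Finset.sum_div]
  refine Finset.sum_congr rfl fun k _ => ?_
  rw [sampleProbR, mul_pow]
  ring

/-- The probability generating function of the hypergeometric distribution is dominated on
`[1, ∞)` by that of the binomial distribution. -/
lemma sum_pow_mul_sampleProbM_le (m w b : ℕ) (hT : 0 < w + b) (hm : m ≤ w + b) {z : ℝ}
    (hz : 1 ≤ z) :
    ∑ k ∈ Finset.range (m + 1), z ^ k * sampleProbM m k w b
      ≤ (1 + (w : ℝ) / ((w : ℝ) + b) * (z - 1)) ^ m := by
  have hT' : (0 : ℝ) < (w : ℝ) + b := by exact_mod_cast hT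
  have hC : (0 : ℝ) < ((w + b).choose m : ℝ) := by exact_mod_cast Nat.choose_pos hm
  have hexp : ∀ k ∈ Finset.range (m + 1), z ^ k * sampleProbM m k w b =
      ∑ j ∈ Finset.range (m + 1), (z - 1) ^ j *
        ((w.choose k * b.choose (m - k) * k.choose j : ℕ) : ℝ) / ((w + b).choose m : ℝ) := by
    intro k hk
    have hk' : k + 1 ≤ m + 1 := by simpa using hk
    have h1 : z ^ k = ∑ j ∈ Finset.range (m + 1), (z - 1) ^ j * (k.choose j : ℝ) := by
      conv_lhs => rw [show z = (z - 1) + 1 by ring, add_pow]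
      simp only [one_pow, mul_one]
      refine Finset.sum_subset (Finset.range_mono hk') fun j _ hj => ?_
      rw [Nat.choose_eq_zero_of_lt (by simpa using hj)]
      simp
    rw [h1, sampleProbM, Finset.sum_mul]
    refine Finset.sum_congr rfl fun j _ => ?_
    push_cast
    ring
  rw [Finset.sum_congr rfl hexp, Finset.sum_comm, add_comm (1 : ℝ), add_pow]
  refine Finset.sum_le_sum fun j hj => ?_
  have hj' : j ≤ m := by simpa [Nat.lt_succ_iff] using hj
  rw [← Finset.sum_div, ← Finset.mul_sum, ← Nat.cast_sum,
    sum_choose_mul_choose_mul_choose m w b j hj', one_pow, mul_one, mul_pow, div_pow,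
    div_le_iff₀ hC]
  have hz' : 0 ≤ (z - 1) ^ j := pow_nonneg (by linarith) j
  have key : (w.choose j : ℝ) * ((w - j + b).choose (m - j) : ℝ) * ((w : ℝ) + b) ^ j
      ≤ (w : ℝ) ^ j * (m.choose j : ℝ) * ((w + b).choose m : ℝ) := by
    rcases lt_or_ge w j with hwj | hwj
    · rw [Nat.choose_eq_zero_of_lt hwj]
      simp only [Nat.cast_zero, zero_mul]
      positivity
    · have h1 := Nat.choose_mul (n := w + b) (k := m) (s := j) hj'
      have h2 := Nat.choose_mul_pow_le (show w ≤ w + b by omega) j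
      have h3 : w - j + b = w + b - j := by omega
      have h4 : w.choose j * (w - j + b).choose (m - j) * (w + b) ^ j
          ≤ w ^ j * m.choose j * (w + b).choose m := by
        calc w.choose j * (w - j + b).choose (m - j) * (w + b) ^ j
            = (w + b - j).choose (m - j) * (w.choose j * (w + b) ^ j) := by rw [h3]; ring
          _ ≤ (w + b - j).choose (m - j) * ((w + b).choose j * w ^ j) :=
            Nat.mul_le_mul_left _ h2
          _ = w ^ j * ((w + b).choose m * m.choose j) := by rw [h1]; ring
          _ = w ^ j * m.choose j * (w + b).choose m := by ring
      exact_mod_cast h4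
  have hd : (0 : ℝ) < ((w : ℝ) + b) ^ j := by positivity
  rw [div_mul_eq_mul_div, div_mul_eq_mul_div, div_mul_eq_mul_div, le_div_iff₀ hd]
  push_cast
  nlinarith [mul_le_mul_of_nonneg_left key hz']

namespace UrnScheme

variable {Ω : Type*} [m0 : MeasurableSpace Ω] {μ : Measure Ω} {mdlM : Bool} {m : ℕ}
  {a b : ℕ → ℤ} {σ : ℤ} {W0 B0 : ℕ} {W B : ℕ → Ω → ℕ} {R : ℕ → Ω → ℕ} {F : Filtration ℕ m0}

lemma total_eq (h : UrnScheme μ mdlM m a b σ W0 B0 W B R F) (n : ℕ) (ω : Ω) :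
    (W n ω : ℤ) + B n ω = ((W0 + B0 : ℕ) : ℤ) + n * σ := by
  induction n with
  | zero => simp [h.initW, h.initB]
  | succ n ih =>
    rw [h.dynW, h.dynB]
    have := h.balanced (m - R (n + 1) ω) (Nat.sub_le _ _)
    push_cast at *
    linear_combination ih + this

lemma total_pos (h : UrnScheme μ mdlM m a b σ W0 B0 W B R F) (n : ℕ) (ω : Ω) :
    0 < W n ω + B n ω := by
  have h1 := h.sampleFit n ω
  have h2 := h.hm
  split_ifs at h1 <;> omega

lemma white_succ (h : UrnScheme μ mdlM m a b σ W0 B0 W B R F) (ham : a m = 0) (n : ℕ) (ω : Ω) :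
    (W (n + 1) ω : ℝ) = W n ω + a (m - 1) * R (n + 1) ω := by
  have h1 := h.dynW n ω
  rw [h.affine _ (Nat.sub_le _ _), ham, Nat.cast_sub (h.sampleLe n ω)] at h1
  have h2 : (W (n + 1) ω : ℤ) = W n ω + a (m - 1) * R (n + 1) ω := by rw [h1]; ring
  exact_mod_cast h2

lemma integrable_comp [IsProbabilityMeasure μ] (h : UrnScheme μ mdlM m a b σ W0 B0 W B R F)
    (n : ℕ) (g : ℕ → ℕ → ℝ) : Integrable (fun ω => g (W n ω) (B n ω)) μ := by
  have hmeas : Measurable (fun ω => g (W n ω) (B n ω)) :=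
    (measurable_of_countable (Function.uncurry g)).comp
      (((h.measW n).mono (F.le n) le_rfl).prodMk ((h.measB n).mono (F.le n) le_rfl))
  set N : ℕ := (((W0 + B0 : ℕ) : ℤ) + n * σ).toNat + 1
  refine Integrable.of_bound hmeas.aestronglyMeasurable
    (∑ i ∈ Finset.range N, ∑ j ∈ Finset.range N, ‖g i j‖) (ae_of_all _ fun ω => ?_)
  have ht := h.total_eq n ω
  have hW : W n ω ∈ Finset.range N := Finset.mem_range.2 (by omega)
  have hB : B n ω ∈ Finset.range N := Finset.mem_range.2 (by omega)
  calc ‖g (W n ω) (B n ω)‖ ≤ ∑ j ∈ Finset.range N, ‖g (W n ω) j‖ :=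
        Finset.single_le_sum (f := fun j => ‖g (W n ω) j‖) (fun _ _ => norm_nonneg _) hB
    _ ≤ _ := Finset.single_le_sum (f := fun i => ∑ j ∈ Finset.range N, ‖g i j‖)
        (fun _ _ => Finset.sum_nonneg fun _ _ => norm_nonneg _) hW

lemma integral_exp_white_succ_le [IsProbabilityMeasure μ]
    (h : UrnScheme μ mdlM m a b σ W0 B0 W B R F) (ham : a m = 0) (n : ℕ) {s : ℝ}
    (hs : 0 ≤ s * a (m - 1)) :
    ∫ ω, Real.exp (s * W (n + 1) ω) ∂μ ≤ ∫ ω, Real.exp (s * W n ω) *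
      (1 + (W n ω : ℝ) / ((W n ω : ℝ) + B n ω) * (Real.exp (s * a (m - 1)) - 1)) ^ m ∂μ := by
  set z := Real.exp (s * a (m - 1)) with hz
  set f : Ω → ℝ := fun ω => Real.exp (s * W n ω) with hf
  set I : ℕ → Ω → ℝ := fun k => ({ω | R (n + 1) ω = k}).indicator fun _ => (1 : ℝ) with hI
  set P : ℕ → Ω → ℝ := fun k ω => if mdlM then sampleProbM m k (W n ω) (B n ω)
    else sampleProbR m k (W n ω) (B n ω) with hP
  have hImeas : ∀ k, MeasurableSet {ω | R (n + 1) ω = k} := fun k =>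
    F.le (n + 1) _ (h.measR n (measurableSet_singleton k))
  have hIint : ∀ k, Integrable (I k) μ := fun k => (integrable_const 1).indicator (hImeas k)
  have hfint : Integrable f μ := h.integrable_comp n fun w _ => Real.exp (s * w)
  have hfI : ∀ k, Integrable (f * I k) μ := fun k => by
    have : f * I k = ({ω | R (n + 1) ω = k}).indicator f := by
      ext ω
      by_cases hω : R (n + 1) ω = k <;> simp [hI, hω]
    rw [this]
    exact hfint.indicator (hImeas k)
  have hfP : ∀ k, Integrable (fun ω => z ^ k * (f ω * P k ω)) μ := fun k =>
    h.integrable_comp n fun w b => z ^ k * (Real.exp (s * w) *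
      if mdlM then sampleProbM m k w b else sampleProbR m k w b)
  have hfsm : StronglyMeasurable[F n] f :=
    ((measurable_of_countable fun w : ℕ => Real.exp (s * w)).comp (h.measW n)).stronglyMeasurable
  have hcond : ∀ k ≤ m, ∫ ω, f ω * I k ω ∂μ = ∫ ω, f ω * P k ω ∂μ := fun k hk => by
    have h1 := condExp_mul_of_stronglyMeasurable_left (m := F n) hfsm (hfI k) (hIint k)
    have h2 := integral_condExp (μ := μ) (f := f * I k) (F.le n)
    calc ∫ ω, f ω * I k ω ∂μ = ∫ ω, (μ[f * I k | F n]) ω ∂μ := h2.symm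
      _ = ∫ ω, f ω * P k ω ∂μ := by
        refine integral_congr_ae ?_
        filter_upwards [h1, h.condLaw n k hk] with ω h3 h4
        rw [h3, Pi.mul_apply, h4]
  have hdecomp : ∀ ω, Real.exp (s * W (n + 1) ω)
      = ∑ k ∈ Finset.range (m + 1), z ^ k * (f ω * I k ω) := fun ω => by
    rw [Finset.sum_eq_single (R (n + 1) ω)]
    · have : I (R (n + 1) ω) ω = 1 := by simp [hI]
      rw [this, h.white_succ ham, hz, hf, ← Real.exp_nat_mul, mul_one, ← Real.exp_add]
      ring_nf
    · intro k _ hk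
      simp [hI, hk.symm]
    · intro hR
      exact absurd (Finset.mem_range_succ_iff.2 (h.sampleLe n ω)) hR
  calc ∫ ω, Real.exp (s * W (n + 1) ω) ∂μ
      = ∑ k ∈ Finset.range (m + 1), z ^ k * ∫ ω, f ω * I k ω ∂μ := by
        simp_rw [hdecomp]
        exact (integral_finsetSum _ fun k _ => (hfI k).const_mul (z ^ k)).trans
          (Finset.sum_congr rfl fun k _ => integral_const_mul _ _)
    _ = ∑ k ∈ Finset.range (m + 1), ∫ ω, z ^ k * (f ω * P k ω) ∂μ :=
        Finset.sum_congr rfl fun k hk => by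
          rw [hcond k (Finset.mem_range_succ_iff.1 hk), integral_const_mul]
    _ = ∫ ω, ∑ k ∈ Finset.range (m + 1), z ^ k * (f ω * P k ω) ∂μ :=
        (integral_finsetSum _ fun k _ => hfP k).symm
    _ ≤ _ := by
        refine integral_mono (integrable_finsetSum _ fun k _ => hfP k)
          (h.integrable_comp n fun w b => Real.exp (s * w) *
            (1 + (w : ℝ) / ((w : ℝ) + b) * (z - 1)) ^ m) fun ω => ?_
        have hsum : ∑ k ∈ Finset.range (m + 1), z ^ k * (f ω * P k ω)
            = f ω * ∑ k ∈ Finset.range (m + 1), z ^ k * P k ω := by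
          rw [Finset.mul_sum]
          exact Finset.sum_congr rfl fun k _ => by ring
        have hT := h.total_pos n ω
        have hfit := h.sampleFit n ω
        simp only [hsum]
        refine mul_le_mul_of_nonneg_left ?_ (Real.exp_pos _).le
        simp only [hP]
        cases mdlM
        · simpa using (sum_pow_mul_sampleProbR m (W n ω) (B n ω) hT z).le
        · simpa using sum_pow_mul_sampleProbM_le m (W n ω) (B n ω) hT (by simpa using hfit)
            (Real.one_le_exp hs)

lemma slope_pos (h : UrnScheme μ mdlM m a b σ W0 B0 W B R F) (ham : a m = 0)
    (hΛ : 0 < urnIndex m a σ) : (0 : ℝ) < a (m - 1) := by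
  have hm : (0 : ℝ) < m := by exact_mod_cast h.hm
  have hσ : (0 : ℝ) < σ := by exact_mod_cast h.hσ
  rw [urnIndex, ham, Int.cast_zero, sub_zero] at hΛ
  exact pos_of_mul_pos_right ((div_pos_iff_of_pos_right hσ).1 hΛ) hm.le

lemma ratio_pos (h : UrnScheme μ mdlM m a b σ W0 B0 W B R F) (hW0 : 1 ≤ W0) :
    0 < ((W0 + B0 : ℕ) : ℝ) / (σ : ℝ) := by
  have hσ : (0 : ℝ) < σ := by exact_mod_cast h.hσ
  have hT : (0 : ℝ) < ((W0 + B0 : ℕ) : ℝ) := by exact_mod_cast (by omega : 0 < W0 + B0)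
  positivity

lemma urnG_pos (h : UrnScheme μ mdlM m a b σ W0 B0 W B R F) {Λ : ℝ} (hΛ : 0 < Λ)
    (hW0 : 1 ≤ W0) (n : ℕ) : 0 < urnG (W0 + B0) σ Λ n := by
  have hτ := h.ratio_pos hW0
  have := Real.Gamma_pos_of_pos hτ
  have := Real.Gamma_pos_of_pos (add_pos hτ hΛ)
  have hn : 0 < (n : ℝ) + ((W0 + B0 : ℕ) : ℝ) / (σ : ℝ) := by positivity
  have := Real.Gamma_pos_of_pos hn
  have := Real.Gamma_pos_of_pos (add_pos hn hΛ)
  rw [urnG, urnQ]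
  positivity

lemma urnG_zero (h : UrnScheme μ mdlM m a b σ W0 B0 W B R F) {Λ : ℝ} (hΛ : 0 < Λ)
    (hW0 : 1 ≤ W0) : urnG (W0 + B0) σ Λ 0 = 1 := by
  have hτ := h.ratio_pos hW0
  have := Real.Gamma_pos_of_pos hτ
  have := Real.Gamma_pos_of_pos (add_pos hτ hΛ)
  rw [urnG, urnQ, Nat.cast_zero, zero_add]
  field_simp

lemma urnG_succ (h : UrnScheme μ mdlM m a b σ W0 B0 W B R F) {Λ : ℝ} (hΛ : 0 < Λ)
    (hW0 : 1 ≤ W0) (n : ℕ) :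
    urnG (W0 + B0) σ Λ (n + 1) * (n + ((W0 + B0 : ℕ) : ℝ) / (σ : ℝ) + Λ)
      = urnG (W0 + B0) σ Λ n * (n + ((W0 + B0 : ℕ) : ℝ) / (σ : ℝ)) := by
  have hτ := h.ratio_pos hW0
  have hn : 0 < (n : ℝ) + ((W0 + B0 : ℕ) : ℝ) / (σ : ℝ) := by positivity
  simp only [urnG]
  set τ := ((W0 + B0 : ℕ) : ℝ) / (σ : ℝ)
  have h1 : ((n + 1 : ℕ) : ℝ) + τ = (n + τ) + 1 := by push_cast; ring
  have h2 : (n : ℝ) + τ + 1 + Λ = (n + τ + Λ) + 1 := by ring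
  have hG := Real.Gamma_pos_of_pos (add_pos hn hΛ)
  rw [h1, h2, Real.Gamma_add_one hn.ne', Real.Gamma_add_one (add_pos hn hΛ).ne']
  have := (add_pos hn hΛ).ne'
  field_simp

lemma total_eq_mul (h : UrnScheme μ mdlM m a b σ W0 B0 W B R F) (n : ℕ) (ω : Ω) :
    (W n ω : ℝ) + B n ω = σ * (n + ((W0 + B0 : ℕ) : ℝ) / (σ : ℝ)) := by
  have hσ : (0 : ℝ) < σ := by exact_mod_cast h.hσ
  have h1 : (W n ω : ℝ) + B n ω = ((W0 + B0 : ℕ) : ℝ) + n * σ := by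
    exact_mod_cast h.total_eq n ω
  rw [h1]
  field_simp
  ring

lemma urnG_succ_mul_total (h : UrnScheme μ mdlM m a b σ W0 B0 W B R F) (ham : a m = 0)
    (hΛ : 0 < urnIndex m a σ) (hW0 : 1 ≤ W0) (n : ℕ) (ω : Ω) :
    urnG (W0 + B0) σ (urnIndex m a σ) (n + 1) *
        ((W n ω : ℝ) + B n ω + m * (a (m - 1) : ℝ))
      = urnG (W0 + B0) σ (urnIndex m a σ) n * ((W n ω : ℝ) + B n ω) := by
  have hσ : (0 : ℝ) < σ := by exact_mod_cast h.hσ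
  have hΛσ : (m : ℝ) * (a (m - 1) : ℝ) = σ * urnIndex m a σ := by
    rw [urnIndex, ham]
    field_simp
    simp
  rw [hΛσ, h.total_eq_mul]
  linear_combination (σ : ℝ) * h.urnG_succ hΛ hW0 n

lemma urnG_succ_le (h : UrnScheme μ mdlM m a b σ W0 B0 W B R F) {Λ : ℝ} (hΛ : 0 < Λ)
    (hW0 : 1 ≤ W0) (n : ℕ) : urnG (W0 + B0) σ Λ (n + 1) ≤ urnG (W0 + B0) σ Λ n := by
  have hτ := h.ratio_pos hW0
  have hn : 0 < (n : ℝ) + ((W0 + B0 : ℕ) : ℝ) / (σ : ℝ) := by positivity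
  refine le_of_mul_le_mul_right ?_ hn
  rw [← h.urnG_succ hΛ hW0 n, mul_add _ _ Λ]
  exact le_add_of_nonneg_right (mul_nonneg (h.urnG_pos hΛ hW0 _).le hΛ.le)

lemma urnG_le_one (h : UrnScheme μ mdlM m a b σ W0 B0 W B R F) {Λ : ℝ} (hΛ : 0 < Λ)
    (hW0 : 1 ≤ W0) (n : ℕ) : urnG (W0 + B0) σ Λ n ≤ 1 := by
  rw [← h.urnG_zero hΛ hW0]
  exact antitone_nat_of_succ_le (h.urnG_succ_le hΛ hW0) (Nat.zero_le n)

lemma urnG_mul_total (h : UrnScheme μ mdlM m a b σ W0 B0 W B R F) {Λ : ℝ}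
    (hone : Λ = 1) (hW0 : 1 ≤ W0) (n : ℕ) (ω : Ω) :
    urnG (W0 + B0) σ Λ n * ((W n ω : ℝ) + B n ω) = ((W0 + B0 : ℕ) : ℝ) := by
  have hσ : (0 : ℝ) < σ := by exact_mod_cast h.hσ
  have hΛ : 0 < Λ := hone ▸ one_pos
  rw [h.total_eq_mul]
  induction n with
  | zero =>
    rw [h.urnG_zero hΛ hW0]
    field_simp
    simp
  | succ n ih =>
    refine Eq.trans ?_ ih
    have := h.urnG_succ hΛ hW0 n
    rw [hone] at this ⊢
    push_cast at this ⊢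
    linear_combination (σ : ℝ) * this

lemma sum_sq_urnG_le (h : UrnScheme μ mdlM m a b σ W0 B0 W B R F) {Λ : ℝ} (hΛ : 1 / 2 < Λ)
    (hW0 : 1 ≤ W0) (n : ℕ) :
    ∑ k ∈ Finset.range n, urnG (W0 + B0) σ Λ (k + 1) ^ 2
      ≤ ((W0 + B0 : ℕ) : ℝ) / (σ : ℝ) / (2 * Λ - 1) := by
  have hτ := h.ratio_pos hW0
  have hΛ0 : 0 < Λ := by linarith
  have hrec := h.urnG_succ hΛ0 hW0
  have hzero := h.urnG_zero hΛ0 hW0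
  set τ := ((W0 + B0 : ℕ) : ℝ) / (σ : ℝ)
  set g := urnG (W0 + B0) σ Λ
  have key : (2 * Λ - 1) * ∑ k ∈ Finset.range n, g (k + 1) ^ 2 + g n ^ 2 * (n + τ) ≤ τ := by
    induction n with
    | zero => simp [hzero]
    | succ n ih =>
      rw [Finset.sum_range_succ]
      push_cast
      have hn : 0 < (n : ℝ) + τ := by positivity
      have h1 : g n = g (n + 1) * (n + τ + Λ) / (n + τ) := by
        rw [hrec n]
        field_simp
      have h2 : g n ^ 2 * (n + τ) - g (n + 1) ^ 2 * (n + 1 + τ) - (2 * Λ - 1) * g (n + 1) ^ 2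
          = g (n + 1) ^ 2 * Λ ^ 2 / (n + τ) := by
        rw [h1]
        field_simp
        ring
      have h3 : 0 ≤ g (n + 1) ^ 2 * Λ ^ 2 / (n + τ) := by positivity
      linarith
  rw [le_div_iff₀ (by linarith)]
  have : 0 ≤ g n ^ 2 * (n + τ) := by positivity
  linarith

/-- One-step comparison of exponential moments, from a bound on the generating function of a
single Bernoulli draw. -/
lemma integral_exp_mul_white_succ_le [IsProbabilityMeasure μ]
    (h : UrnScheme μ mdlM m a b σ W0 B0 W B R F) (ham : a m = 0) (n : ℕ) {s s' d : ℝ}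
    (hs : 0 ≤ s' * a (m - 1)) {r : ℝ → ℝ}
    (hr : ∀ x, 0 ≤ x → x ≤ 1 → 1 + x * (Real.exp (s' * a (m - 1)) - 1) ≤ Real.exp (r x))
    (hstep : ∀ ω, s' * W n ω + m * r ((W n ω : ℝ) / ((W n ω : ℝ) + B n ω)) ≤ s * W n ω + d) :
    ∫ ω, Real.exp (s' * W (n + 1) ω) ∂μ ≤ Real.exp d * ∫ ω, Real.exp (s * W n ω) ∂μ := by
  refine (h.integral_exp_white_succ_le ham n hs).trans ?_
  rw [← integral_const_mul]
  refine integral_mono (h.integrable_comp n fun w b => Real.exp (s' * w) *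
      (1 + (w : ℝ) / ((w : ℝ) + b) * (Real.exp (s' * a (m - 1)) - 1)) ^ m)
    (h.integrable_comp n fun w _ => Real.exp d * Real.exp (s * w)) fun ω => ?_
  have hT : (0 : ℝ) < (W n ω : ℝ) + B n ω := by exact_mod_cast h.total_pos n ω
  have hx0 : 0 ≤ (W n ω : ℝ) / ((W n ω : ℝ) + B n ω) := by positivity
  have hx1 : (W n ω : ℝ) / ((W n ω : ℝ) + B n ω) ≤ 1 := by
    rw [div_le_one hT]
    exact le_add_of_nonneg_right (Nat.cast_nonneg _)
  have hpos : 0 ≤ 1 + (W n ω : ℝ) / ((W n ω : ℝ) + B n ω) *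
      (Real.exp (s' * a (m - 1)) - 1) := by
    have := mul_nonneg hx0 (sub_nonneg.2 (Real.one_le_exp hs))
    linarith
  calc _ ≤ Real.exp (s' * W n ω) *
        Real.exp (r ((W n ω : ℝ) / ((W n ω : ℝ) + B n ω))) ^ m :=
        mul_le_mul_of_nonneg_left (pow_le_pow_left₀ hpos (hr _ hx0 hx1) m) (Real.exp_pos _).le
    _ = Real.exp (s' * W n ω + m * r ((W n ω : ℝ) / ((W n ω : ℝ) + B n ω))) := by
        rw [← Real.exp_nat_mul, ← Real.exp_add]
    _ ≤ Real.exp (s * W n ω + d) := Real.exp_le_exp.2 (hstep ω)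
    _ = Real.exp d * Real.exp (s * W n ω) := by rw [← Real.exp_add, add_comm]

lemma integral_exp_mul_frakW_le [IsProbabilityMeasure μ]
    (h : UrnScheme μ mdlM m a b σ W0 B0 W B R F) (ham : a m = 0)
    (hΛ : 0 < urnIndex m a σ) (hW0 : 1 ≤ W0) {θ : ℝ} (hθ : 0 ≤ θ) (n : ℕ) :
    ∫ ω, Real.exp (θ * frakW σ (urnIndex m a σ) (W0 + B0) W n ω) ∂μ
      ≤ Real.exp (θ * W0 + m * (a (m - 1) : ℝ) ^ 2 * θ ^ 2 *
        ∑ k ∈ Finset.range n, urnG (W0 + B0) σ (urnIndex m a σ) (k + 1) ^ 2) := by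
  have hp := h.slope_pos ham hΛ
  have hgp := h.urnG_pos hΛ hW0
  have hg0 := h.urnG_zero hΛ hW0
  have hrec := h.urnG_succ_mul_total ham hΛ hW0
  simp only [frakW, ← mul_assoc]
  set g := urnG (W0 + B0) σ (urnIndex m a σ)
  set p : ℝ := (a (m - 1) : ℝ)
  induction n with
  | zero => simp [hg0, h.initW]
  | succ n ih =>
    have hu : 0 ≤ θ * g (n + 1) * p := mul_nonneg (mul_nonneg hθ (hgp _).le) hp.le
    refine (h.integral_exp_mul_white_succ_le ham n (s := θ * g n)
      (d := m * p ^ 2 * θ ^ 2 * g (n + 1) ^ 2) hu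
      (fun x hx0 hx1 => one_add_mul_exp_sub_one_le hx0 hx1 hu) fun ω => ?_).trans ?_
    · have hT : (0 : ℝ) < (W n ω : ℝ) + B n ω := by exact_mod_cast h.total_pos n ω
      have h1 : g n = g (n + 1) * ((W n ω : ℝ) + B n ω + m * p) / ((W n ω : ℝ) + B n ω) := by
        rw [hrec n ω]
        field_simp
      rw [h1]
      refine le_of_eq ?_
      field_simp
      ring
    · refine (mul_le_mul_of_nonneg_left ih (Real.exp_pos _).le).trans_eq ?_
      rw [← Real.exp_add, Finset.sum_range_succ]
      ring_nf

lemma integral_exp_mul_one_add_urnG_mul_frakW_le [IsProbabilityMeasure μ]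
    (h : UrnScheme μ mdlM m a b σ W0 B0 W B R F) (ham : a m = 0)
    (hΛ : 0 < urnIndex m a σ) (hW0 : 1 ≤ W0) {c : ℝ} (hc : 0 ≤ c)
    (hcp : 4 * c * (a (m - 1) : ℝ) ≤ 1) (n : ℕ) :
    ∫ ω, Real.exp (c * (1 + urnG (W0 + B0) σ (urnIndex m a σ) n) *
        frakW σ (urnIndex m a σ) (W0 + B0) W n ω) ∂μ ≤ Real.exp (2 * c * W0) := by
  have hp := h.slope_pos ham hΛ
  have hgp := h.urnG_pos hΛ hW0
  have hg0 := h.urnG_zero hΛ hW0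
  have hg1 := h.urnG_le_one hΛ hW0
  have hanti := h.urnG_succ_le hΛ hW0
  have hrec := h.urnG_succ_mul_total ham hΛ hW0
  simp only [frakW, ← mul_assoc]
  set g := urnG (W0 + B0) σ (urnIndex m a σ)
  set p : ℝ := (a (m - 1) : ℝ)
  induction n with
  | zero =>
    simp only [hg0, h.initW, mul_one, integral_const, probReal_univ, one_smul]
    refine (Real.exp_le_exp.2 (le_of_eq ?_))
    ring
  | succ n ih =>
    set θ := c * (1 + g (n + 1)) with hθ
    have hg' := hgp (n + 1)
    have hg1' := hg1 (n + 1)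
    have hθ0 : 0 ≤ θ := mul_nonneg hc (by linarith)
    have hθ2 : θ ≤ 2 * c := by rw [hθ]; nlinarith
    have hu : 0 ≤ θ * g (n + 1) * p := mul_nonneg (mul_nonneg hθ0 hg'.le) hp.le
    have hθp : θ * p ≤ 1 / 2 := by nlinarith
    have hu1 : θ * g (n + 1) * p ≤ 1 := by
      have : θ * p * g (n + 1) ≤ 1 / 2 * 1 :=
        mul_le_mul hθp hg1' hg'.le (by norm_num)
      linarith
    refine (h.integral_exp_mul_white_succ_le ham n (s := c * (1 + g n) * g n) (d := 0) hu
      (fun x hx0 _ => one_add_mul_exp_sub_one_le_exp_mul hx0 hu hu1) fun ω => ?_).trans ?_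
    · have hT : (0 : ℝ) < (W n ω : ℝ) + B n ω := by exact_mod_cast h.total_pos n ω
      have h1 : m * p * g (n + 1) / ((W n ω : ℝ) + B n ω) = g n - g (n + 1) := by
        rw [div_eq_iff hT.ne']
        linear_combination hrec n ω
      have h2 : θ * g (n + 1) * W n ω + m * ((W n ω : ℝ) / ((W n ω : ℝ) + B n ω) *
          (θ * g (n + 1) * p + (θ * g (n + 1) * p) ^ 2))
          = (θ * g n + p * θ ^ 2 * g (n + 1) * (g n - g (n + 1))) * W n ω := by
        linear_combination (θ * W n ω + p * θ ^ 2 * g (n + 1) * W n ω) * h1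
      rw [h2, add_zero]
      refine mul_le_mul_of_nonneg_right ?_ (Nat.cast_nonneg _)
      have h3 : p * θ ^ 2 * g (n + 1) ≤ c * g n := by
        have h4 : p * θ ^ 2 ≤ c := by nlinarith
        exact mul_le_mul h4 (hanti n) hg'.le hc
      have h5 := mul_le_mul_of_nonneg_right h3 (sub_nonneg.2 (hanti n))
      rw [hθ] at h5 ⊢
      linarith
    · rwa [Real.exp_zero, one_mul]

end UrnScheme

/-- Tails of the limit `𝔚_∞` in triangular urns: Subgaussian for
`Λ > 1/2` (with `𝔚_∞ ≤ T₀` a.s. when `Λ = 1`), finite moment generating function near `0`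
for `Λ ≤ 1/2`. -/
theorem triangular_tails {Ω : Type*} [m0 : MeasurableSpace Ω] (μ : Measure Ω)
    [IsProbabilityMeasure μ] (mdlM : Bool) (m : ℕ) (a b : ℕ → ℤ) (σ : ℤ) (W0 B0 : ℕ)
    (W B : ℕ → Ω → ℕ) (R : ℕ → Ω → ℕ) (F : Filtration ℕ m0)
    (hurn : UrnScheme μ mdlM m a b σ W0 B0 W B R F)
    (ham : a m = 0) (hΛlo : 0 < urnIndex m a σ) (hΛhi : urnIndex m a σ ≤ 1)
    (hW0 : 1 ≤ W0) (hB0 : urnIndex m a σ = 1 → 1 ≤ B0)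
    (Winf : Ω → ℝ)
    (hWinf : ∀ᵐ ω ∂μ, Tendsto (fun n : ℕ => frakW σ (urnIndex m a σ) (W0 + B0) W n ω)
      atTop (𝓝 (Winf ω))) :
    (1 / 2 < urnIndex m a σ →
      (∃ c C : ℝ, 0 < c ∧ 0 < C ∧ ∀ t : ℝ, 0 < t →
        (μ {ω | t ≤ |Winf ω|}).toReal ≤ C * Real.exp (-c * t ^ 2)) ∧
      (urnIndex m a σ = 1 → ∀ᵐ ω ∂μ, Winf ω ≤ ((W0 + B0 : ℕ) : ℝ))) ∧
    (urnIndex m a σ ≤ 1 / 2 →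
      ∃ ε : ℝ, 0 < ε ∧ ∀ t : ℝ, |t| < ε →
        Integrable (fun ω => Real.exp (t * Winf ω)) μ) := by
  set Λ := urnIndex m a σ with hΛ
  have hnn : ∀ᵐ ω ∂μ, 0 ≤ Winf ω := by
    filter_upwards [hWinf] with ω hω
    exact ge_of_tendsto' hω fun n =>
      mul_nonneg (hurn.urnG_pos hΛlo hW0 n).le (Nat.cast_nonneg _)
  have hlim : ∀ θ : ℝ, ∀ᵐ ω ∂μ, Tendsto
      (fun n : ℕ => Real.exp (θ * frakW σ Λ (W0 + B0) W n ω)) atTop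
      (𝓝 (Real.exp (θ * Winf ω))) := fun θ => by
    filter_upwards [hWinf] with ω hω
    exact (Real.continuous_exp.tendsto _).comp (hω.const_mul θ)
  have hint : ∀ (θ : ℝ) (n : ℕ),
      Integrable (fun ω => Real.exp (θ * frakW σ Λ (W0 + B0) W n ω)) μ := fun θ n =>
    hurn.integrable_comp n fun w _ => Real.exp (θ * (urnG (W0 + B0) σ Λ n * w))
  refine ⟨fun hhalf => ⟨?_, fun hone => ?_⟩, fun _ => ?_⟩
  · have hp := hurn.slope_pos ham hΛlo
    have hm : (0 : ℝ) < m := by exact_mod_cast hurn.hm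
    have hτ := hurn.ratio_pos hW0
    set τ : ℝ := ((W0 + B0 : ℕ) : ℝ) / (σ : ℝ) with hτdef
    have h2 : 0 < 2 * Λ - 1 := by linarith
    set K : ℝ := m * (a (m - 1) : ℝ) ^ 2 * (τ / (2 * Λ - 1)) with hK
    have hKpos : 0 < K := by positivity
    refine ⟨1 / (8 * K), Real.exp ((W0 : ℝ) ^ 2 / (2 * K)), by positivity, Real.exp_pos _,
      fun t ht => ?_⟩
    set θ : ℝ := t / (2 * K) with hθ
    have hθpos : 0 < θ := by positivity
    obtain ⟨hI, hle⟩ := integrable_and_integral_le_of_tendsto_ae (hint θ)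
      (fun n ω => (Real.exp_pos _).le) (K := Real.exp (θ * W0 + K * θ ^ 2)) (fun n => by
        refine (hurn.integral_exp_mul_frakW_le ham hΛlo hW0 hθpos.le n).trans
          (Real.exp_le_exp.2 ?_)
        have hsum := hurn.sum_sq_urnG_le hhalf hW0 n
        have : (m : ℝ) * (a (m - 1) : ℝ) ^ 2 * θ ^ 2 *
            ∑ k ∈ Finset.range n, urnG (W0 + B0) σ Λ (k + 1) ^ 2
            ≤ m * (a (m - 1) : ℝ) ^ 2 * θ ^ 2 * (τ / (2 * Λ - 1)) :=
          mul_le_mul_of_nonneg_left hsum (by positivity)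
        rw [hK]
        linarith) (hlim θ)
    have hmarkov := mul_meas_ge_le_integral_of_nonneg
      (ae_of_all μ fun ω => (Real.exp_pos (θ * Winf ω)).le) hI (Real.exp (θ * t))
    have hsub : (μ {ω | t ≤ |Winf ω|}).toReal
        ≤ μ.real {ω | Real.exp (θ * t) ≤ Real.exp (θ * Winf ω)} := by
      refine ENNReal.toReal_mono (measure_ne_top _ _) (measure_mono_ae ?_)
      filter_upwards [hnn] with ω hω h
      have h' : t ≤ |Winf ω| := h
      rw [abs_of_nonneg hω] at h'
      exact Real.exp_le_exp.2 (mul_le_mul_of_nonneg_left h' hθpos.le)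
    calc (μ {ω | t ≤ |Winf ω|}).toReal
        ≤ Real.exp (θ * W0 + K * θ ^ 2) / Real.exp (θ * t) := by
          rw [le_div_iff₀ (Real.exp_pos _), mul_comm]
          exact (mul_le_mul_of_nonneg_left hsub (Real.exp_pos _).le).trans (hmarkov.trans hle)
      _ ≤ _ := by
          rw [← Real.exp_sub, ← Real.exp_add]
          refine Real.exp_le_exp.2 (sub_nonneg.1 ?_)
          have : (W0 : ℝ) ^ 2 / (2 * K) + -(1 / (8 * K)) * t ^ 2
              - (θ * W0 + K * θ ^ 2 - θ * t) = (t / 2 - W0) ^ 2 / (2 * K) := by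
            rw [hθ]
            field_simp
            ring
          rw [this]
          positivity
  · filter_upwards [hWinf] with ω hω
    refine le_of_tendsto' hω fun n => ?_
    have hstep := hurn.urnG_mul_total hone hW0 n ω
    have hB : (0 : ℝ) ≤ B n ω := Nat.cast_nonneg _
    have hg := (hurn.urnG_pos hΛlo hW0 n).le
    rw [frakW]
    linarith [mul_nonneg hg hB]
  · have hp := hurn.slope_pos ham hΛlo
    set c : ℝ := 1 / (4 * (a (m - 1) : ℝ)) with hc
    have hcpos : 0 < c := by positivity
    obtain ⟨hI, -⟩ := integrable_and_integral_le_of_tendsto_ae (hint c)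
      (fun n ω => (Real.exp_pos _).le) (K := Real.exp (2 * c * W0)) (fun n => by
        refine le_trans ?_ (hurn.integral_exp_mul_one_add_urnG_mul_frakW_le ham hΛlo hW0 hcpos.le
          (by rw [hc]; field_simp; exact le_rfl) n)
        refine integral_mono (hint c n) (hurn.integrable_comp n fun w _ =>
          Real.exp (c * (1 + urnG (W0 + B0) σ Λ n) * (urnG (W0 + B0) σ Λ n * w))) fun ω => ?_
        have hg := (hurn.urnG_pos hΛlo hW0 n).le
        refine Real.exp_le_exp.2 (mul_le_mul_of_nonneg_right ?_
          (mul_nonneg hg (Nat.cast_nonneg _)))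
        nlinarith) (hlim c)
    have hmeas : AEStronglyMeasurable Winf μ := by
      refine aestronglyMeasurable_of_tendsto_ae atTop (fun n => ?_) hWinf
      exact (hurn.integrable_comp n fun w _ => urnG (W0 + B0) σ Λ n * w).aestronglyMeasurable
    refine ⟨c, hcpos, fun t ht => hI.mono'
      (Real.continuous_exp.comp_aestronglyMeasurable (hmeas.const_mul t)) ?_⟩
    filter_upwards [hnn] with ω hω
    rw [Real.norm_of_nonneg (Real.exp_pos _).le]
    exact Real.exp_le_exp.2 (mul_le_mul_of_nonneg_right ((le_abs_self t).trans ht.le) hω)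
end
end
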